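/- arXiv:1706.00310 — 8 statements merged into one kernel-verified Lean document; each statement's English description precedes it below -/
import Mathlib

section
/- For the random walk on the chambers of any central hyperplane arrangement driven by a separating probability weight w on the faces, and for every time t ∈ ℕ, the separation distance satisfies s(t) ≥ P(T > t), where T is the first time that the product of the i.i.d. faces chosen so far is a chamber. -/
open Finset

/-- The sign vector of a point `p` with respect to the linear functionals `f i`
defining the hyperplanes `H i = ker (f i)`. -/
noncomputable def signVec {n m : ℕ} (f : Fin m → ((Fin n → ℝ) →ₗ[ℝ] ℝ))
    (p : Fin n → ℝ) : Fin m → SignType :=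
  fun i => SignType.sign (f i p)

/-- A face is a sign vector realized by some point. -/
def IsFace {n m : ℕ} (f : Fin m → ((Fin n → ℝ) →ₗ[ℝ] ℝ)) (F : Fin m → SignType) : Prop :=
  ∃ p : Fin n → ℝ, signVec f p = F

/-- A chamber is a realized sign vector all of whose coordinates are nonzero. -/
def IsChamber {n m : ℕ} (f : Fin m → ((Fin n → ℝ) →ₗ[ℝ] ℝ)) (C : Fin m → SignType) : Prop :=
  IsFace f C ∧ ∀ i, C i ≠ 0

/-- The face product on sign vectors. -/
def signProd {m : ℕ} (F G : Fin m → SignType) : Fin m → SignType :=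
  fun i => if F i ≠ 0 then F i else G i

/-- The partial product `F^k ∘ ⋯ ∘ F^1` of the first `k` chosen faces
(`ω s` is the face chosen at step `s+1`). -/
def faceProdUpTo {m t : ℕ} (ω : Fin t → (Fin m → SignType)) : ℕ → (Fin m → SignType)
  | 0 => fun _ => 0
  | k + 1 => if h : k < t then signProd (ω ⟨k, h⟩) (faceProdUpTo ω k) else faceProdUpTo ω k

/-- The chamber reached after `t` steps of the walk started at `x0`. -/
def chamberAt {m t : ℕ} (x0 : Fin m → SignType) (ω : Fin t → (Fin m → SignType)) :
    Fin m → SignType :=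
  signProd (faceProdUpTo ω t) x0

/-- Probability of an event depending on the first `t` i.i.d. faces drawn from `w`. -/
noncomputable def faceProb {m : ℕ} (w : (Fin m → SignType) → ℝ) (t : ℕ)
    (E : Set (Fin t → (Fin m → SignType))) : ℝ :=
  ∑ ω : Fin t → (Fin m → SignType), Set.indicator E (fun ω => ∏ s, w (ω s)) ω

open Classical in
lemma sum_faceProb_chamber {n m : ℕ} (f : Fin m → ((Fin n → ℝ) →ₗ[ℝ] ℝ))
    (w : (Fin m → SignType) → ℝ) (t : ℕ) :
    ∑ x, (if IsChamber f x then faceProb w t {ω | faceProdUpTo ω t = x} else 0) =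
      faceProb w t {ω | IsChamber f (faceProdUpTo ω t)} := by
  have h : ∀ x : Fin m → SignType,
      (if IsChamber f x then faceProb w t {ω | faceProdUpTo ω t = x} else 0) =
      ∑ ω : Fin t → (Fin m → SignType), if faceProdUpTo ω t = x then
        (if IsChamber f x then ∏ s, w (ω s) else 0) else 0 := by
    intro x
    by_cases hx : IsChamber f x <;> simp [faceProb, Set.indicator_apply, hx]
  simp_rw [h]
  rw [Finset.sum_comm]
  simp [faceProb, Set.indicator_apply]

lemma faceProb_compl {n m : ℕ} (f : Fin m → ((Fin n → ℝ) →ₗ[ℝ] ℝ))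
    (w : (Fin m → SignType) → ℝ) (hw1 : ∑ F, w F = 1) (t : ℕ) :
    faceProb w t {ω | ¬ IsChamber f (faceProdUpTo ω t)} =
      1 - faceProb w t {ω | IsChamber f (faceProdUpTo ω t)} := by
  classical
  have h1 : ∑ ω : Fin t → (Fin m → SignType), ∏ s, w (ω s) = 1 := by
    have := Finset.prod_univ_sum (fun _ : Fin t => (Finset.univ : Finset (Fin m → SignType)))
      (fun _ F => w F)
    rw [Fintype.piFinset_univ] at this
    rw [← this]
    simp [hw1]
  rw [eq_sub_iff_add_eq, ← h1]
  unfold faceProb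
  rw [← Finset.sum_add_distrib]
  refine Finset.sum_congr rfl fun ω _ => ?_
  by_cases hx : IsChamber f (faceProdUpTo ω t) <;> simp [Set.indicator_apply, hx]

lemma isChamber_neg {n m : ℕ} (f : Fin m → ((Fin n → ℝ) →ₗ[ℝ] ℝ))
    (x : Fin m → SignType) (hx : IsChamber f x) : IsChamber f (fun i => - x i) := by
  obtain ⟨⟨p, hp⟩, h⟩ := hx
  refine ⟨⟨-p, ?_⟩, ?_⟩
  · funext i
    rw [← hp]
    simp [signVec, Left.sign_neg]
  · intro i hi
    have := h i
    beta_reduce at hi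
    revert hi this
    generalize x i = a
    revert a
    decide

lemma signProd_neg_eq {m : ℕ} (F x : Fin m → SignType) (hx : ∀ i, x i ≠ 0) :
    signProd F (fun i => - x i) = x ↔ F = x := by
  rw [funext_iff, funext_iff]
  refine forall_congr' fun i => ?_
  have := hx i
  revert this
  unfold signProd
  beta_reduce
  generalize x i = a
  generalize F i = b
  revert a b
  decide

/-- For the walk on the chambers of any central hyperplane arrangement driven by a
separating probability weight `w` on faces, with stationary distribution `π`, the
separation distance satisfies `s(t) ≥ P(T > t)`, where `T` is the first time the
product of the chosen faces is a chamber (equivalently, `T > t` iff the product of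
the first `t` faces is not a chamber). -/
theorem separation_ge_tail {n m : ℕ}
    (f : Fin m → ((Fin n → ℝ) →ₗ[ℝ] ℝ))
    (hf0 : ∀ i, f i ≠ 0)
    (hfdist : ∀ i j, i ≠ j → LinearMap.ker (f i) ≠ LinearMap.ker (f j))
    (w : (Fin m → SignType) → ℝ)
    (hw0 : ∀ F, 0 ≤ w F) (hw1 : ∑ F, w F = 1)
    (hwface : ∀ F, w F ≠ 0 → IsFace f F)
    (hwsep : ∀ i : Fin m, ∃ F, 0 < w F ∧ F i ≠ 0)
    (π : (Fin m → SignType) → ℝ)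
    (hπ0 : ∀ C, 0 ≤ π C) (hπch : ∀ C, π C ≠ 0 → IsChamber f C) (hπ1 : ∑ C, π C = 1)
    (hπstat : ∀ C, π C = ∑ x, π x * ∑ F, (if signProd F x = C then w F else 0))
    (t : ℕ) :
    faceProb w t {ω | ¬ IsChamber f (faceProdUpTo ω t)} ≤
      ⨆ x0 : {C : Fin m → SignType // IsChamber f C},
        (1 - ⨅ x : {C : Fin m → SignType // IsChamber f C},
          faceProb w t {ω | chamberAt (x0 : Fin m → SignType) ω = (x : Fin m → SignType)}
            / π (x : Fin m → SignType)) := by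
  classical
  obtain ⟨x, hx0, hxA⟩ : ∃ x, 0 < π x ∧ faceProb w t {ω | faceProdUpTo ω t = x} ≤
      faceProb w t {ω | IsChamber f (faceProdUpTo ω t)} * π x := by
    by_contra! hcon
    obtain ⟨y, hy⟩ : ∃ y, 0 < π y := by
      by_contra! h
      have : ∑ C, π C ≤ 0 := Finset.sum_nonpos fun C _ => h C
      linarith
    have hnn : ∀ x, 0 ≤ faceProb w t {ω | faceProdUpTo ω t = x} := fun x =>
      Finset.sum_nonneg fun ω _ =>
        Set.indicator_nonneg (fun ω _ => Finset.prod_nonneg fun s _ => hw0 _) ω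
    have hlt : ∑ x, faceProb w t {ω | IsChamber f (faceProdUpTo ω t)} * π x <
        ∑ x, (if IsChamber f x then faceProb w t {ω | faceProdUpTo ω t = x} else 0) := by
      refine Finset.sum_lt_sum (fun x _ => ?_) ⟨y, Finset.mem_univ _, ?_⟩
      · rcases (hπ0 x).eq_or_lt with h | h
        · rw [← h, mul_zero]
          split_ifs
          · exact hnn x
          · exact le_rfl
        · rw [if_pos (hπch x h.ne')]
          exact (hcon x h).le
      · rw [if_pos (hπch y hy.ne')]
        exact hcon y hy
    rw [sum_faceProb_chamber, ← Finset.mul_sum, hπ1, mul_one] at hlt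
    exact lt_irrefl _ hlt
  have hxc := hπch x hx0.ne'
  rw [faceProb_compl f w hw1 t]
  refine le_trans ?_ (le_ciSup (Set.finite_range _).bddAbove ⟨_, isChamber_neg f x hxc⟩)
  refine sub_le_sub_left ?_ _
  refine le_trans (ciInf_le (Set.finite_range _).bddBelow ⟨x, hxc⟩) ?_
  rw [div_le_iff₀ hx0]
  simpa only [chamberAt, signProd_neg_eq _ x hxc.2] using hxA
end

section
/- Suppose a group G of invertible linear maps of ℝ^n preserves a central hyperplane arrangement (permutes its hyperplanes), acts transitively on the set of chambers, and the face weights w are G-invariant. Then for every starting chamber x_0, every t ∈ ℕ with P(T = t) > 0, and every chamber C, one has P(C^t_{x_0} = C | T = t) = 1/ℓ, where ℓ is the number of chambers; that is, T is a strong stationary time for the walk (whose stationary distribution is uniform on chambers). -/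
open Finset

theorem aux_factor {n m : ℕ} (f : Fin m → ((Fin n → ℝ) →ₗ[ℝ] ℝ))
    (hf0 : ∀ i, f i ≠ 0)
    (G : Subgroup ((Fin n → ℝ) ≃ₗ[ℝ] (Fin n → ℝ)))
    (hGpres : ∀ g : G, ∀ i : Fin m, ∃ j : Fin m,
      Submodule.map ((g : (Fin n → ℝ) ≃ₗ[ℝ] (Fin n → ℝ)) : (Fin n → ℝ) →ₗ[ℝ] (Fin n → ℝ))
        (LinearMap.ker (f i)) = LinearMap.ker (f j)) (g : G) (i : Fin m) :
    ∃ (j : Fin m) (c : ℝ), c ≠ 0 ∧ ∀ p, f i ((g : (Fin n → ℝ) ≃ₗ[ℝ] (Fin n → ℝ)) p) = c * f j p := by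
  obtain ⟨j, hj⟩ := hGpres g⁻¹ i
  have hker : ∀ p, f j p = 0 ↔ f i ((g : (Fin n → ℝ) ≃ₗ[ℝ] (Fin n → ℝ)) p) = 0 := by
    intro p
    rw [← LinearMap.mem_ker, ← hj, Submodule.mem_map]
    constructor
    · rintro ⟨q, hq, rfl⟩
      have : (g : (Fin n → ℝ) ≃ₗ[ℝ] (Fin n → ℝ))
          (((g⁻¹ : G) : (Fin n → ℝ) ≃ₗ[ℝ] (Fin n → ℝ)) q) = q := by
        rw [← LinearEquiv.mul_apply, ← Subgroup.coe_mul]; simp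
      simpa [this] using hq
    · intro h
      refine ⟨_, LinearMap.mem_ker.2 h, ?_⟩
      show ((g⁻¹ : G) : (Fin n → ℝ) ≃ₗ[ℝ] (Fin n → ℝ))
          ((g : (Fin n → ℝ) ≃ₗ[ℝ] (Fin n → ℝ)) p) = p
      rw [← LinearEquiv.mul_apply, ← Subgroup.coe_mul]; simp
  obtain ⟨v, hv⟩ : ∃ v, f j v ≠ 0 := by
    by_contra! h
    exact hf0 j (LinearMap.ext h)
  refine ⟨j, f i ((g : (Fin n → ℝ) ≃ₗ[ℝ] (Fin n → ℝ)) v) / f j v,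
    div_ne_zero (fun h => hv ((hker v).2 h)) hv, fun p => ?_⟩
  have h1 : f j (p - (f j p / f j v) • v) = 0 := by
    simp [hv]
  have h2 := (hker _).1 h1
  simp only [map_sub, map_smul, smul_eq_mul] at h2
  field_simp at h2 ⊢
  linarith

theorem aux_act {n m : ℕ} (f : Fin m → ((Fin n → ℝ) →ₗ[ℝ] ℝ))
    (hf0 : ∀ i, f i ≠ 0)
    (hfdist : ∀ i j, i ≠ j → LinearMap.ker (f i) ≠ LinearMap.ker (f j))
    (G : Subgroup ((Fin n → ℝ) ≃ₗ[ℝ] (Fin n → ℝ)))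
    (hGpres : ∀ g : G, ∀ i : Fin m, ∃ j : Fin m,
      Submodule.map ((g : (Fin n → ℝ) ≃ₗ[ℝ] (Fin n → ℝ)) : (Fin n → ℝ) →ₗ[ℝ] (Fin n → ℝ))
        (LinearMap.ker (f i)) = LinearMap.ker (f j)) (g : G) :
    ∃ A : (Fin m → SignType) ≃ (Fin m → SignType),
      (∀ F H, A (signProd F H) = signProd (A F) (A H)) ∧ (A (fun _ => 0) = fun _ => 0) ∧
      (∀ p, A (signVec f p) = signVec f ((g : (Fin n → ℝ) ≃ₗ[ℝ] (Fin n → ℝ)) p)) ∧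
      (∀ F, (∀ i, A F i ≠ 0) ↔ ∀ i, F i ≠ 0) := by
  choose τ c hc hτ using aux_factor f hf0 G hGpres g
  have hinj : Function.Injective τ := by
    intro i i' h
    by_contra hne
    apply hfdist i i' hne
    ext p
    have h1 := hτ i ((g : (Fin n → ℝ) ≃ₗ[ℝ] (Fin n → ℝ)).symm p)
    have h2 := hτ i' ((g : (Fin n → ℝ) ≃ₗ[ℝ] (Fin n → ℝ)).symm p)
    rw [LinearEquiv.apply_symm_apply] at h1 h2
    rw [LinearMap.mem_ker, LinearMap.mem_ker, h1, h2, h]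
    simp [hc]
  have hsurj : Function.Surjective τ := Finite.surjective_of_injective hinj
  have hs : ∀ i, SignType.sign (c i) ≠ 0 := fun i => by simpa using hc i
  let a : (Fin m → SignType) → (Fin m → SignType) :=
    fun F i => SignType.sign (c i) * F (τ i)
  have ha : Function.Injective a := by
    intro F H h
    funext k
    obtain ⟨i, rfl⟩ := hsurj k
    have := congrFun h i
    exact mul_left_cancel₀ (hs i) this
  refine ⟨Equiv.ofBijective a (Finite.injective_iff_bijective.1 ha), ?_, ?_, ?_, ?_⟩
  · intro F H
    funext i
    by_cases h : F (τ i) = 0 <;> simp [a, signProd, h, hs, hc]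
  · funext i
    simp [a]
  · intro p
    funext i
    simp [a, signVec, hτ, sign_mul]
  · intro F
    simp only [Equiv.ofBijective_apply, a]
    constructor
    · intro h k
      obtain ⟨i, rfl⟩ := hsurj k
      exact right_ne_zero_of_mul (h i)
    · intro h i
      exact mul_ne_zero (hs i) (h _)

theorem aux_faceProd {m t : ℕ} (A : (Fin m → SignType) ≃ (Fin m → SignType))
    (h1 : ∀ F H, A (signProd F H) = signProd (A F) (A H)) (h0 : A (fun _ => 0) = fun _ => 0)
    (ω : Fin t → (Fin m → SignType)) (k : ℕ) :
    faceProdUpTo (fun s => A (ω s)) k = A (faceProdUpTo ω k) := by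
  induction k with
  | zero => simp [faceProdUpTo, h0]
  | succ k ih =>
    by_cases h : k < t
    · simp [faceProdUpTo, h, ih, h1]
    · simp [faceProdUpTo, h, ih]

/-- If a group `G` of invertible linear maps preserves the arrangement, acts transitively
on the chambers, and the weights `w` are `G`-invariant, then `T` (the first time the
product of the chosen faces is a chamber) is a strong stationary time: for every start
`x0`, every `t` with `P(T = t) > 0` and every chamber `C`,
`P(C^t_{x0} = C | T = t) = 1/ℓ`, where `ℓ` is the number of chambers. -/
theorem strong_stationary_time {n m : ℕ}
    (f : Fin m → ((Fin n → ℝ) →ₗ[ℝ] ℝ))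
    (hf0 : ∀ i, f i ≠ 0)
    (hfdist : ∀ i j, i ≠ j → LinearMap.ker (f i) ≠ LinearMap.ker (f j))
    (w : (Fin m → SignType) → ℝ)
    (hw0 : ∀ F, 0 ≤ w F) (hw1 : ∑ F, w F = 1)
    (hwface : ∀ F, w F ≠ 0 → IsFace f F)
    (hwsep : ∀ i : Fin m, ∃ F, 0 < w F ∧ F i ≠ 0)
    (G : Subgroup ((Fin n → ℝ) ≃ₗ[ℝ] (Fin n → ℝ)))
    (hGpres : ∀ g : G, ∀ i : Fin m, ∃ j : Fin m,
      Submodule.map ((g : (Fin n → ℝ) ≃ₗ[ℝ] (Fin n → ℝ)) : (Fin n → ℝ) →ₗ[ℝ] (Fin n → ℝ))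
        (LinearMap.ker (f i)) = LinearMap.ker (f j))
    (hGtrans : ∀ C D : Fin m → SignType, IsChamber f C → IsChamber f D →
      ∃ g : G, ∀ p : Fin n → ℝ, signVec f p = C →
        signVec f ((g : (Fin n → ℝ) ≃ₗ[ℝ] (Fin n → ℝ)) p) = D)
    (hGinv : ∀ g : G, ∀ p : Fin n → ℝ,
      w (signVec f ((g : (Fin n → ℝ) ≃ₗ[ℝ] (Fin n → ℝ)) p)) = w (signVec f p))
    (x0 : Fin m → SignType) (hx0 : IsChamber f x0) (t : ℕ)
    (hpos : 0 < faceProb w t {ω | IsChamber f (faceProdUpTo ω t) ∧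
      ∀ k < t, ¬ IsChamber f (faceProdUpTo ω k)})
    (C : Fin m → SignType) (hC : IsChamber f C) :
    faceProb w t ({ω | chamberAt x0 ω = C} ∩ {ω | IsChamber f (faceProdUpTo ω t) ∧
        ∀ k < t, ¬ IsChamber f (faceProdUpTo ω k)})
      / faceProb w t {ω | IsChamber f (faceProdUpTo ω t) ∧
        ∀ k < t, ¬ IsChamber f (faceProdUpTo ω k)}
    = 1 / (Nat.card {C : Fin m → SignType // IsChamber f C} : ℝ) := by
  classical
  set E : Set (Fin t → (Fin m → SignType)) := {ω | IsChamber f (faceProdUpTo ω t) ∧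
      ∀ k < t, ¬ IsChamber f (faceProdUpTo ω k)} with hE
  have hEq : ({ω | chamberAt x0 ω = C} ∩ E) = ({ω | faceProdUpTo ω t = C} ∩ E) := by
    ext ω
    simp only [Set.mem_inter_iff, Set.mem_ofPred_eq, and_congr_left_iff]
    intro hω
    have : chamberAt x0 ω = faceProdUpTo ω t := by
      funext i
      simp [chamberAt, signProd, hω.1.2 i]
    rw [this]
  rw [hEq]
  have key : ∀ D, IsChamber f D → faceProb w t ({ω | faceProdUpTo ω t = D} ∩ E)
      = faceProb w t ({ω | faceProdUpTo ω t = C} ∩ E) := by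
    intro D hD
    obtain ⟨g, hg⟩ := hGtrans D C hD hC
    obtain ⟨A, h1, h0, hA, hne⟩ := aux_act f hf0 hfdist G hGpres g
    have hAD : A D = C := by
      obtain ⟨p, hp⟩ := hD.1
      rw [← hp, hA, hg p hp]
    have hface : ∀ F, IsFace f (A F) ↔ IsFace f F := by
      intro F
      constructor
      · rintro ⟨p, hp⟩
        refine ⟨(g : (Fin n → ℝ) ≃ₗ[ℝ] (Fin n → ℝ)).symm p, A.injective ?_⟩
        rw [hA, LinearEquiv.apply_symm_apply, hp]
      · rintro ⟨p, rfl⟩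
        exact ⟨_, (hA p).symm⟩
    have hch : ∀ F, IsChamber f (A F) ↔ IsChamber f F := fun F =>
      and_congr (hface F) (hne F)
    have hwA : ∀ F, w (A F) = w F := by
      intro F
      by_cases hF : IsFace f F
      · obtain ⟨p, rfl⟩ := hF
        rw [hA, hGinv]
      · rw [not_imp_comm.1 (hwface F) hF,
          not_imp_comm.1 (hwface (A F)) (fun h => hF ((hface F).1 h))]
    unfold faceProb
    refine Fintype.sum_equiv (Equiv.piCongrRight fun _ => A) _ _ fun ω => ?_
    have hmem : (Equiv.piCongrRight (fun _ => A)) ω ∈ ({ω | faceProdUpTo ω t = C} ∩ E) ↔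
        ω ∈ ({ω | faceProdUpTo ω t = D} ∩ E) := by
      have hp : ∀ k, faceProdUpTo ((Equiv.piCongrRight (fun _ => A)) ω) k
          = A (faceProdUpTo ω k) := aux_faceProd A h1 h0 ω
      simp only [hE, Set.mem_inter_iff, Set.mem_ofPred_eq, hp, hch, ← hAD, A.injective.eq_iff]
    rw [Set.indicator_apply, Set.indicator_apply]
    simp only [hmem]
    simp [hwA]
  have hsum : faceProb w t E = ∑ D : {C : Fin m → SignType // IsChamber f C},
      faceProb w t ({ω | faceProdUpTo ω t = D.1} ∩ E) := by
    unfold faceProb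
    rw [Finset.sum_comm]
    refine Finset.sum_congr rfl fun ω _ => ?_
    by_cases hω : ω ∈ E
    · rw [Finset.sum_eq_single ⟨faceProdUpTo ω t, hω.1⟩]
      · rw [Set.indicator_of_mem hω, Set.indicator_of_mem]
        exact ⟨rfl, hω⟩
      · intro D _ hD
        apply Set.indicator_of_notMem
        rintro ⟨h, -⟩
        exact hD (Subtype.ext h.symm)
      · simp
    · rw [Set.indicator_of_notMem hω]
      symm
      exact Finset.sum_eq_zero fun D _ => Set.indicator_of_notMem (fun h => hω h.2) _
  rw [Finset.sum_congr rfl (fun D _ => key D.1 D.2), Finset.sum_const, Finset.card_univ,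
    nsmul_eq_mul, ← Nat.card_eq_fintype_card] at hsum
  rw [hsum] at hpos ⊢
  have hN : faceProb w t ({ω | faceProdUpTo ω t = C} ∩ E) ≠ 0 := right_ne_zero_of_mul hpos.ne'
  have hK := left_ne_zero_of_mul hpos.ne'
  field_simp
end

section
/- Suppose a group G of invertible linear maps of ℝ^n preserves a central hyperplane arrangement, acts transitively on the set of chambers, and the face weights w are G-invariant. Then for every t ∈ ℕ the separation distance of the chamber walk equals exactly the tail probability of T: s(t) = P(T > t), where T is the first time that the product of the chosen faces is a chamber. -/
open Finset

lemma chamber_exists {n m : ℕ} (f : Fin m → ((Fin n → ℝ) →ₗ[ℝ] ℝ)) (hf0 : ∀ i, f i ≠ 0) :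
    ∃ C, IsChamber f C := by
  obtain ⟨p, hp⟩ := Module.Dual.exists_forall_ne_zero_of_forall_exists f fun i => by
    by_contra! h
    exact hf0 i (LinearMap.ext h)
  exact ⟨signVec f p, ⟨p, rfl⟩, fun i => by simpa [signVec, sign_eq_zero_iff] using hp i⟩

lemma signVec_neg {n m : ℕ} (f : Fin m → ((Fin n → ℝ) →ₗ[ℝ] ℝ)) (p : Fin n → ℝ) :
    signVec f (-p) = fun i => - signVec f p i := by
  funext i
  simp [signVec, Left.sign_neg]

lemma IsChamber.neg' {n m : ℕ} {f : Fin m → ((Fin n → ℝ) →ₗ[ℝ] ℝ)} {C : Fin m → SignType}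
    (h : IsChamber f C) : IsChamber f (fun i => - C i) := by
  obtain ⟨⟨p, rfl⟩, h2⟩ := h
  refine ⟨⟨-p, signVec_neg f p⟩, fun i => ?_⟩
  have := h2 i
  change - signVec f p i ≠ 0
  revert this
  generalize signVec f p i = a
  revert a
  decide

/-- An arrangement-preserving map induces a bijection of sign vectors. -/
lemma exists_signEquiv {n m : ℕ} (f : Fin m → ((Fin n → ℝ) →ₗ[ℝ] ℝ))
    (hfdist : ∀ i j, i ≠ j → LinearMap.ker (f i) ≠ LinearMap.ker (f j))
    (hf0 : ∀ i, f i ≠ 0)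
    (g : (Fin n → ℝ) ≃ₗ[ℝ] (Fin n → ℝ))
    (hg : ∀ i : Fin m, ∃ j : Fin m,
      Submodule.map (g : (Fin n → ℝ) →ₗ[ℝ] (Fin n → ℝ)) (LinearMap.ker (f i))
        = LinearMap.ker (f j)) :
    ∃ Φ : (Fin m → SignType) ≃ (Fin m → SignType),
      Φ (fun _ => 0) = (fun _ => 0) ∧
      (∀ F H, Φ (signProd F H) = signProd (Φ F) (Φ H)) ∧
      (∀ p, signVec f (g p) = Φ (signVec f p)) := by
  choose σ hσ using hg
  have hinj : Function.Injective σ := by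
    intro i j hij
    by_contra hne
    apply hfdist i j hne
    have h : Submodule.map (g : (Fin n → ℝ) →ₗ[ℝ] (Fin n → ℝ)) (LinearMap.ker (f i)) =
      Submodule.map (g : (Fin n → ℝ) →ₗ[ℝ] (Fin n → ℝ)) (LinearMap.ker (f j)) := by
      rw [hσ, hσ, hij]
    exact Submodule.map_injective_of_injective g.injective h
  have hbij : Function.Bijective σ := Finite.injective_iff_bijective.mp hinj
  have hc : ∀ i, ∃ c : ℝ, c ≠ 0 ∧ ∀ p, f (σ i) (g p) = c * f i p := by
    intro i
    obtain ⟨q, hq⟩ : ∃ q, f i q ≠ 0 := by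
      by_contra! h
      exact hf0 i (LinearMap.ext h)
    have hz : ∀ p, f i p = 0 ↔ f (σ i) (g p) = 0 := by
      intro p
      rw [← LinearMap.mem_ker, ← LinearMap.mem_ker, ← hσ i]
      constructor
      · intro h
        exact Submodule.mem_map_of_mem (f := (g : (Fin n → ℝ) →ₗ[ℝ] (Fin n → ℝ))) h
      · rintro ⟨r, hr, hrp⟩
        have : r = p := g.injective hrp
        exact this ▸ hr
    refine ⟨f (σ i) (g q) / f i q, div_ne_zero (fun h => hq ((hz q).2 h)) hq, fun p => ?_⟩
    have h1 : f i (p - (f i p / f i q) • q) = 0 := by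
      simp [hq]
    have h2 := (hz _).1 h1
    simp only [map_sub, map_smul, smul_eq_mul] at h2
    field_simp at h2 ⊢
    linarith
  choose c hc0 hc using hc
  let e := Equiv.ofBijective σ hbij
  have hes : ∀ i, e.symm (σ i) = i := fun i => e.symm_apply_apply i
  let ε : Fin m → SignType := fun i => SignType.sign (c i)
  have hε : ∀ i, ε i ≠ 0 := fun i => by simpa [ε, sign_eq_zero_iff] using hc0 i
  have hmul : ∀ a b : SignType, a ≠ 0 → a * (a * b) = b := by decide
  have hmul0 : ∀ a b : SignType, a ≠ 0 → (a * b ≠ 0 ↔ b ≠ 0) := by decide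
  let Φ : (Fin m → SignType) ≃ (Fin m → SignType) :=
    { toFun := fun F j => ε (e.symm j) * F (e.symm j)
      invFun := fun F i => ε i * F (e i)
      left_inv := fun F => by funext i; simp [hmul _ _ (hε _)]
      right_inv := fun F => by funext i; simp [hmul _ _ (hε _)] }
  refine ⟨Φ, ?_, ?_, ?_⟩
  · funext j; simp [Φ]
  · intro F H
    funext j
    change ε (e.symm j) * (if F (e.symm j) ≠ 0 then F (e.symm j) else H (e.symm j)) =
      if ε (e.symm j) * F (e.symm j) ≠ 0 then ε (e.symm j) * F (e.symm j)
        else ε (e.symm j) * H (e.symm j)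
    simp only [hmul0 _ _ (hε _)]
    split_ifs <;> rfl
  · intro p
    funext j
    obtain ⟨i, rfl⟩ := hbij.2 j
    change SignType.sign (f (σ i) (g p)) = ε (e.symm (σ i)) * SignType.sign (f (e.symm (σ i)) p)
    rw [hes, hc, sign_mul]

lemma faceProdUpTo_equiv {m t : ℕ} (Φ : (Fin m → SignType) ≃ (Fin m → SignType))
    (h0 : Φ (fun _ => 0) = (fun _ => 0))
    (hm : ∀ F H, Φ (signProd F H) = signProd (Φ F) (Φ H))
    (ω : Fin t → (Fin m → SignType)) (k : ℕ) :
    faceProdUpTo (fun s => Φ (ω s)) k = Φ (faceProdUpTo ω k) := by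
  induction k with
  | zero => simp [faceProdUpTo, h0]
  | succ k ih =>
    simp only [faceProdUpTo]
    split_ifs
    · rw [ih, hm]
    · exact ih

lemma faceProb_equiv {m t : ℕ} (w : (Fin m → SignType) → ℝ)
    (Φ : (Fin m → SignType) ≃ (Fin m → SignType))
    (h0 : Φ (fun _ => 0) = (fun _ => 0))
    (hm : ∀ F H, Φ (signProd F H) = signProd (Φ F) (Φ H))
    (hw : ∀ F, w (Φ F) = w F) (x : Fin m → SignType) :
    faceProb w t {ω | faceProdUpTo ω t = x} = faceProb w t {ω | faceProdUpTo ω t = Φ x} := by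
  classical
  unfold faceProb
  refine Fintype.sum_equiv (Equiv.piCongrRight fun _ : Fin t => Φ) _ _ fun ω => ?_
  have h : (Equiv.piCongrRight fun _ : Fin t => Φ) ω = fun s => Φ (ω s) := rfl
  rw [h]
  simp only [Set.indicator_apply, Set.mem_ofPred_eq, faceProdUpTo_equiv Φ h0 hm, hw,
    Φ.injective.eq_iff]

lemma faceProb_mono {m t : ℕ} (w : (Fin m → SignType) → ℝ) (hw0 : ∀ F, 0 ≤ w F)
    {A B : Set (Fin t → (Fin m → SignType))} (h : A ⊆ B) : faceProb w t A ≤ faceProb w t B :=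
  Finset.sum_le_sum fun ω _ =>
    Set.indicator_le_indicator_of_subset h (fun ω => Finset.prod_nonneg fun s _ => hw0 _) ω

lemma faceProb_compl_s2 {m t : ℕ} (w : (Fin m → SignType) → ℝ) (hw1 : ∑ F, w F = 1)
    (A : Set (Fin t → (Fin m → SignType))) : faceProb w t A + faceProb w t Aᶜ = 1 := by
  classical
  unfold faceProb
  rw [← Finset.sum_add_distrib]
  have : ∀ ω : Fin t → (Fin m → SignType), A.indicator (fun ω => ∏ s, w (ω s)) ω
      + Aᶜ.indicator (fun ω => ∏ s, w (ω s)) ω = ∏ s, w (ω s) := fun ω =>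
    congrFun (Set.indicator_self_add_compl A (fun ω => ∏ s, w (ω s))) ω
  simp only [this]
  have h := Finset.prod_univ_sum (fun _ : Fin t => (Finset.univ : Finset (Fin m → SignType)))
    (fun _ F => w F)
  rw [Fintype.piFinset_univ] at h
  rw [← h]
  simp [hw1]

open Classical in
lemma faceProb_sum {n m t : ℕ} (f : Fin m → ((Fin n → ℝ) →ₗ[ℝ] ℝ))
    (w : (Fin m → SignType) → ℝ) :
    faceProb w t {ω | IsChamber f (faceProdUpTo ω t)} =
      ∑ x : {C : Fin m → SignType // IsChamber f C},
        faceProb w t {ω | faceProdUpTo ω t = (x : Fin m → SignType)} := by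
  unfold faceProb
  rw [Finset.sum_comm]
  refine Finset.sum_congr rfl fun ω _ => ?_
  simp only [Set.indicator_apply, Set.mem_ofPred_eq]
  by_cases h : IsChamber f (faceProdUpTo ω t)
  · rw [if_pos h, Finset.sum_eq_single ⟨_, h⟩]
    · simp
    · intro b _ hb
      rw [if_neg]
      intro hh
      exact hb (Subtype.ext hh.symm)
    · simp
  · rw [if_neg h, Finset.sum_eq_zero]
    intro x _
    rw [if_neg]
    intro hh
    exact h (hh ▸ x.2)

/-- Under a chamber-transitive, arrangement-preserving group action with `G`-invariant
weights, the separation distance (with respect to the stationary distribution, which is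
uniform on the `ℓ` chambers) equals exactly the tail of `T`:
`s(t) = P(T > t)`, where `T > t` iff the product of the first `t` faces is not a chamber. -/
theorem separation_eq_tail {n m : ℕ}
    (f : Fin m → ((Fin n → ℝ) →ₗ[ℝ] ℝ))
    (hf0 : ∀ i, f i ≠ 0)
    (hfdist : ∀ i j, i ≠ j → LinearMap.ker (f i) ≠ LinearMap.ker (f j))
    (w : (Fin m → SignType) → ℝ)
    (hw0 : ∀ F, 0 ≤ w F) (hw1 : ∑ F, w F = 1)
    (hwface : ∀ F, w F ≠ 0 → IsFace f F)
    (hwsep : ∀ i : Fin m, ∃ F, 0 < w F ∧ F i ≠ 0)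
    (G : Subgroup ((Fin n → ℝ) ≃ₗ[ℝ] (Fin n → ℝ)))
    (hGpres : ∀ g : G, ∀ i : Fin m, ∃ j : Fin m,
      Submodule.map ((g : (Fin n → ℝ) ≃ₗ[ℝ] (Fin n → ℝ)) : (Fin n → ℝ) →ₗ[ℝ] (Fin n → ℝ))
        (LinearMap.ker (f i)) = LinearMap.ker (f j))
    (hGtrans : ∀ C D : Fin m → SignType, IsChamber f C → IsChamber f D →
      ∃ g : G, ∀ p : Fin n → ℝ, signVec f p = C →
        signVec f ((g : (Fin n → ℝ) ≃ₗ[ℝ] (Fin n → ℝ)) p) = D)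
    (hGinv : ∀ g : G, ∀ p : Fin n → ℝ,
      w (signVec f ((g : (Fin n → ℝ) ≃ₗ[ℝ] (Fin n → ℝ)) p)) = w (signVec f p))
    (t : ℕ) :
    (⨆ x0 : {C : Fin m → SignType // IsChamber f C},
        (1 - ⨅ x : {C : Fin m → SignType // IsChamber f C},
          faceProb w t {ω | chamberAt (x0 : Fin m → SignType) ω = (x : Fin m → SignType)}
            / (1 / (Nat.card {C : Fin m → SignType // IsChamber f C} : ℝ))))
      = faceProb w t {ω | ¬ IsChamber f (faceProdUpTo ω t)} := by
  classical
  obtain ⟨C0, hC0⟩ := chamber_exists f hf0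
  haveI : Nonempty {C : Fin m → SignType // IsChamber f C} := ⟨⟨C0, hC0⟩⟩
  have hq : ∀ C D, IsChamber f C → IsChamber f D →
      faceProb w t {ω | faceProdUpTo ω t = C} = faceProb w t {ω | faceProdUpTo ω t = D} := by
    intro C D hC hD
    obtain ⟨g, hg⟩ := hGtrans C D hC hD
    obtain ⟨Φ, h0, hm, hΦ⟩ := exists_signEquiv f hfdist hf0 g (hGpres g)
    have hwΦ : ∀ F, w (Φ F) = w F := by
      intro F
      by_cases hF : IsFace f F
      · obtain ⟨p, rfl⟩ := hF
        rw [← hΦ, hGinv]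
      · have h1 : w F = 0 := by
          by_contra h
          exact hF (hwface F h)
        have h2 : w (Φ F) = 0 := by
          by_contra h
          obtain ⟨q, hq⟩ := hwface _ h
          apply hF
          refine ⟨(g : (Fin n → ℝ) ≃ₗ[ℝ] (Fin n → ℝ)).symm q, Φ.injective ?_⟩
          rw [← hΦ, LinearEquiv.apply_symm_apply, hq]
        rw [h1, h2]
    obtain ⟨p, hp⟩ := hC.1
    have hCD : Φ C = D := by rw [← hg p hp, hΦ, hp]
    rw [faceProb_equiv w Φ h0 hm hwΦ, hCD]
  have hsum : ∀ C, IsChamber f C → faceProb w t {ω | faceProdUpTo ω t = C} *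
      (Nat.card {C : Fin m → SignType // IsChamber f C} : ℝ) =
      1 - faceProb w t {ω | ¬ IsChamber f (faceProdUpTo ω t)} := by
    intro C hC
    have h1 := faceProb_compl_s2 (t := t) w hw1 {ω | IsChamber f (faceProdUpTo ω t)}
    have h2 : ({ω | IsChamber f (faceProdUpTo ω t)}ᶜ : Set (Fin t → (Fin m → SignType))) =
      {ω | ¬ IsChamber f (faceProdUpTo ω t)} := rfl
    rw [h2, faceProb_sum, Finset.sum_congr rfl (fun (x : {C : Fin m → SignType // IsChamber f C}) _ => hq x C x.2 hC)] at h1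
    rw [Finset.sum_const, nsmul_eq_mul, Finset.card_univ, ← Nat.card_eq_fintype_card] at h1
    linarith
  have hinf : ∀ x0 : {C : Fin m → SignType // IsChamber f C},
      (⨅ x : {C : Fin m → SignType // IsChamber f C},
          faceProb w t {ω | chamberAt (x0 : Fin m → SignType) ω = (x : Fin m → SignType)}
            / (1 / (Nat.card {C : Fin m → SignType // IsChamber f C} : ℝ))) =
      1 - faceProb w t {ω | ¬ IsChamber f (faceProdUpTo ω t)} := by
    intro x0
    apply le_antisymm
    · refine (ciInf_le (Set.finite_range _).bddBelow ⟨_, x0.2.neg'⟩).trans (le_of_eq ?_)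
      rw [← hsum _ x0.2.neg', one_div, div_inv_eq_mul]
      congr 2
      ext ω
      simp only [Set.mem_ofPred_eq, chamberAt, funext_iff, signProd]
      refine forall_congr' fun i => ?_
      have := x0.2.2 i
      revert this
      generalize faceProdUpTo ω t i = a
      generalize (x0 : Fin m → SignType) i = b
      revert a b
      decide
    · refine le_ciInf fun x => ?_
      rw [← hsum _ x.2, one_div, div_inv_eq_mul]
      refine mul_le_mul_of_nonneg_right (faceProb_mono w hw0 ?_) (Nat.cast_nonneg _)
      intro ω hω
      simp only [Set.mem_ofPred_eq] at hω ⊢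
      funext i
      simp [chamberAt, signProd, hω, x.2.2 i]
  simp only [hinf, sub_sub_cancel, ciSup_const]
end

section
/- In the general coupon collector setting, suppose μ(A_i) = b for every i with 0 < b < 1, μ(A_i ∩ A_j) = d for all i ≠ j, 2b ≤ 1 + d, and d ≤ b². Then for every t ∈ ℕ, Var[N_t] ≤ m(1−b)^t, and consequently P(T > t) ≥ 1 − 1/(m(1−b)^t). -/
open Finset

/-- The number of uncollected coupons at time `t`: the number of indices `i` such that
no draw `ω s`, `s < t`, lies in `A i`. -/
def uncollected {α : Type*} [Fintype α] [DecidableEq α] {m t : ℕ}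
    (A : Fin m → Finset α) (ω : Fin t → α) : ℕ :=
  (Finset.univ.filter (fun i : Fin m => ∀ s : Fin t, ω s ∉ A i)).card

lemma avoid_sum {α : Type*} [Fintype α] [DecidableEq α] (w : α → ℝ) (hw1 : ∑ a, w a = 1)
    (S : Finset α) (t : ℕ) :
    (∑ ω : Fin t → α, (∏ s, w (ω s)) * (if ∀ s, ω s ∉ S then (1:ℝ) else 0))
      = (1 - ∑ a ∈ S, w a) ^ t := by
  have h1 : (1 - ∑ a ∈ S, w a) = ∑ a, (if a ∉ S then w a else 0) := by
    rw [← hw1, ← Finset.sum_filter, ← Finset.sum_filter_add_sum_filter_not univ (fun a => a ∈ S) w]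
    simp
  rw [h1, Fintype.sum_pow]
  refine Finset.sum_congr rfl fun ω _ => ?_
  by_cases h : ∀ s, ω s ∉ S
  · rw [if_pos h, mul_one]
    exact Finset.prod_congr rfl fun s _ => by rw [if_pos (h s)]
  · rw [if_neg h, mul_zero]
    push Not at h
    obtain ⟨s, hs⟩ := h
    exact (Finset.prod_eq_zero (Finset.mem_univ s) (by simp [hs])).symm

lemma uncollected_cast {α : Type*} [Fintype α] [DecidableEq α] {m t : ℕ}
    (A : Fin m → Finset α) (ω : Fin t → α) :
    (uncollected A ω : ℝ) = ∑ i, (if ∀ s, ω s ∉ A i then (1:ℝ) else 0) := by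
  simp [uncollected]

lemma mean_eq {α : Type*} [Fintype α] [DecidableEq α]
    (w : α → ℝ) (hw1 : ∑ a, w a = 1)
    {m : ℕ} (A : Fin m → Finset α) (b : ℝ)
    (hb : ∀ i, ∑ a ∈ A i, w a = b) (t : ℕ) :
    (∑ ω : Fin t → α, (∏ s, w (ω s)) * (uncollected A ω : ℝ)) = m * (1 - b) ^ t := by
  simp_rw [uncollected_cast, Finset.mul_sum]
  rw [Finset.sum_comm]
  simp_rw [avoid_sum w hw1, hb]
  simp

lemma second_le {α : Type*} [Fintype α] [DecidableEq α]
    (w : α → ℝ) (hw1 : ∑ a, w a = 1)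
    {m : ℕ} (A : Fin m → Finset α) (b d : ℝ) 
    (hb : ∀ i, ∑ a ∈ A i, w a = b)
    (hd : ∀ i j, i ≠ j → ∑ a ∈ A i ∩ A j, w a = d)
    (hbd : 2 * b ≤ 1 + d) (hdb : d ≤ b ^ 2) (t : ℕ) :
    (∑ ω : Fin t → α, (∏ s, w (ω s)) * (uncollected A ω : ℝ) ^ 2)
      ≤ m * (1 - b) ^ t + (m * (1 - b) ^ t) ^ 2 := by
  have key : ∀ i j : Fin m, (∑ ω : Fin t → α, (∏ s, w (ω s)) *
      ((if ∀ s, ω s ∉ A i then (1:ℝ) else 0) * (if ∀ s, ω s ∉ A j then (1:ℝ) else 0)))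
      = (1 - ∑ a ∈ A i ∪ A j, w a) ^ t := by
    intro i j
    rw [← avoid_sum w hw1]
    refine Finset.sum_congr rfl fun ω _ => ?_
    congr 1
    by_cases h1 : ∀ s, ω s ∉ A i <;> by_cases h2 : ∀ s, ω s ∉ A j <;>
      simp [h1, h2, forall_and]
  have key2 : ∀ i j : Fin m, (1 - ∑ a ∈ A i ∪ A j, w a) ^ t
      ≤ (if i = j then (1 - b) ^ t else 0) + ((1 - b) ^ t) ^ 2 := by
    intro i j
    by_cases hij : i = j
    · subst hij
      simp only [Finset.union_self, hb, if_true]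
      nlinarith [sq_nonneg ((1 - b) ^ t)]
    · have h := Finset.sum_union_inter (s₁ := A i) (s₂ := A j) (f := w)
      rw [hb, hb, hd i j hij] at h
      rw [if_neg hij, zero_add, ← pow_mul, mul_comm t 2, pow_mul]
      apply pow_le_pow_left₀ <;> nlinarith
  calc _ = ∑ i : Fin m, ∑ j : Fin m, (1 - ∑ a ∈ A i ∪ A j, w a) ^ t := by
        simp_rw [← key, uncollected_cast, sq, Finset.sum_mul_sum, Finset.mul_sum]
        rw [Finset.sum_comm]
        refine Finset.sum_congr rfl fun i _ => ?_
        rw [Finset.sum_comm]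
    _ ≤ ∑ i : Fin m, ∑ j : Fin m, ((if i = j then (1 - b) ^ t else 0) + ((1 - b) ^ t) ^ 2) :=
        Finset.sum_le_sum fun i _ => Finset.sum_le_sum fun j _ => key2 i j
    _ = _ := by
        simp [Finset.sum_add_distrib]
        ring

/-- General coupon collector: if `μ(A i) = b` for every `i` with `0 < b < 1`,
`μ(A i ∩ A j) = d` for `i ≠ j`, `2b ≤ 1 + d` and `d ≤ b²`, then
`Var[N_t] ≤ m (1-b)^t`, and consequently `P(T > t) ≥ 1 - 1/(m (1-b)^t)`
(the event `T > t` being that some coupon is still uncollected at time `t`).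
Probabilities and expectations are over `t` i.i.d. draws with law `w`. -/
theorem coupon_variance_and_tail {α : Type*} [Fintype α] [DecidableEq α]
    (w : α → ℝ) (hw0 : ∀ a, 0 ≤ w a) (hw1 : ∑ a, w a = 1)
    {m : ℕ} (hm : 0 < m) (A : Fin m → Finset α) (b d : ℝ)
    (hb0 : 0 < b) (hb1 : b < 1)
    (hb : ∀ i, ∑ a ∈ A i, w a = b)
    (hd : ∀ i j, i ≠ j → ∑ a ∈ A i ∩ A j, w a = d)
    (hbd : 2 * b ≤ 1 + d) (hdb : d ≤ b ^ 2) (t : ℕ) :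
    (∑ ω : Fin t → α, (∏ s, w (ω s)) * (uncollected A ω : ℝ) ^ 2)
        - (∑ ω : Fin t → α, (∏ s, w (ω s)) * (uncollected A ω : ℝ)) ^ 2
      ≤ m * (1 - b) ^ t ∧
    (∑ ω : Fin t → α, if 1 ≤ uncollected A ω then ∏ s, w (ω s) else 0)
      ≥ 1 - 1 / (m * (1 - b) ^ t) := by
  have hE := mean_eq w hw1 A b hb t
  have hS := second_le w hw1 A b d hb hd hbd hdb t
  have hEpos : (0:ℝ) < m * (1 - b) ^ t := by
    have : (0:ℝ) < 1 - b := by linarith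
    positivity
  refine ⟨by rw [hE]; linarith, ?_⟩
  have hone : ∑ ω : Fin t → α, ∏ s, w (ω s) = 1 := by
    rw [← Fintype.sum_pow, hw1, one_pow]
  generalize (m:ℝ) * (1 - b) ^ t = E at *
  have hcheb : ∑ ω : Fin t → α, (E ^ 2 * ((∏ s, w (ω s)) -
        (if 1 ≤ uncollected A ω then ∏ s, w (ω s) else 0)))
      ≤ ∑ ω : Fin t → α, ((∏ s, w (ω s)) * (uncollected A ω : ℝ) ^ 2
        - 2 * E * ((∏ s, w (ω s)) * (uncollected A ω : ℝ)) + E ^ 2 * ∏ s, w (ω s)) := by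
    refine Finset.sum_le_sum fun ω _ => ?_
    have hp : 0 ≤ ∏ s, w (ω s) := Finset.prod_nonneg fun s _ => hw0 _
    by_cases h : 1 ≤ uncollected A ω
    · rw [if_pos h]
      nlinarith [mul_nonneg hp (sq_nonneg ((uncollected A ω : ℝ) - E))]
    · have h0 : uncollected A ω = 0 := by omega
      simp [h0]
  rw [← Finset.mul_sum, Finset.sum_sub_distrib, Finset.sum_add_distrib, Finset.sum_sub_distrib,
    ← Finset.mul_sum, ← Finset.mul_sum, hE, hone] at hcheb
  generalize (∑ ω : Fin t → α, if 1 ≤ uncollected A ω then ∏ s, w (ω s) else 0) = P at *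
  have h3 : E * (E * (1 - P)) ≤ E * 1 := by nlinarith
  have h4 := le_of_mul_le_mul_left h3 hEpos
  have h5 : 1 - P ≤ 1 / E := by
    rw [le_div_iff₀ hEpos]; linarith
  linarith
end

section
/- For the Tsetlin library with weights w_1,…,w_n, let w_min = min_i w_i and let t_* solve Σ_{i=1}^n e^{−w_i t_*} = 1/2. Then for every c with 0 < c < t_* w_min / 2 and every integer t ≤ t_* − 2c/w_min, the separation distance satisfies s(t) ≥ 1 − e^{−e^{c/2}/2} − (4 w_min² t_* − 2c w_min)/c² − 1/c. -/
open Finset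

/-- Move book `i` to the front.  A state `σ : Equiv.Perm (Fin n)` sends each book to its
position (position `0` is the front): book `i` goes to position `0`, books before the old
position of `i` are pushed back by one, and the rest keep their positions. -/
def moveToFront {n : ℕ} (i : Fin n) (σ : Equiv.Perm (Fin n)) : Equiv.Perm (Fin n) :=
  (Fin.cycleRange (σ i)) * σ

/-- The Tsetlin library chain after `k` steps started from `x0`, driven by the books `ω`
chosen at each of the first `t` steps. -/
def tsetlinWalk {n t : ℕ} (x0 : Equiv.Perm (Fin n)) (ω : Fin t → Fin n) :
    ℕ → Equiv.Perm (Fin n)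
  | 0 => x0
  | k + 1 => if h : k < t then moveToFront (ω ⟨k, h⟩) (tsetlinWalk x0 ω k)
             else tsetlinWalk x0 ω k

/-- Probability of an event depending on the first `t` i.i.d. book choices with law `w`. -/
noncomputable def bookProb {n : ℕ} (w : Fin n → ℝ) (t : ℕ) (E : Set (Fin t → Fin n)) : ℝ :=
  ∑ ω : Fin t → Fin n, Set.indicator E (fun ω => ∏ s, w (ω s)) ω

/-- The Luce model: the stationary distribution of the Tsetlin library, obtained by
sampling books without replacement with probabilities proportional to their weights. -/
noncomputable def luce {n : ℕ} (w : Fin n → ℝ) (σ : Equiv.Perm (Fin n)) : ℝ :=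
  ∏ k : Fin n, w (σ.symm k) / ∑ j ∈ Finset.univ.filter (fun j => k ≤ σ j), w j

/-- The separation distance at time `t` of the Tsetlin library with weights `w`. -/
noncomputable def tsetlinSep {n : ℕ} (w : Fin n → ℝ) (t : ℕ) : ℝ :=
  ⨆ x0 : Equiv.Perm (Fin n), (1 - ⨅ x : Equiv.Perm (Fin n),
    bookProb w t {ω | tsetlinWalk x0 ω t = x} / luce w x)

theorem coe_cycleRange' {n : ℕ} (p q : Fin n) :
    ((Fin.cycleRange p q : Fin n) : ℕ) = if q < p then (q : ℕ) + 1 else if q = p then 0 else q := by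
  split_ifs with h1 h2
  · exact Fin.coe_cycleRange_of_lt h1
  · subst h2
    rw [Fin.coe_cycleRange_of_le le_rfl]; simp
  · have : p < q := lt_of_le_of_ne (not_lt.mp h1) (Ne.symm h2)
    rw [Fin.cycleRange_of_gt this]

theorem mtf_lt {n : ℕ} (a : Fin n) (σ : Equiv.Perm (Fin n)) (i j : Fin n) :
    moveToFront a σ i < moveToFront a σ j ↔ j ≠ a ∧ (i = a ∨ σ i < σ j) := by
  have hi : σ i = σ a ↔ i = a := σ.injective.eq_iff
  have hj : σ j = σ a ↔ j = a := σ.injective.eq_iff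
  unfold moveToFront
  simp only [Equiv.Perm.mul_apply, Fin.lt_def, coe_cycleRange', ← hi, ← hj, Ne]
  simp only [Fin.ext_iff]
  split_ifs <;> omega

theorem walk_succ {n t : ℕ} (x0 : Equiv.Perm (Fin n)) (ω : Fin t → Fin n) (k : ℕ) (h : k < t) :
    tsetlinWalk x0 ω (k+1) = moveToFront (ω ⟨k, h⟩) (tsetlinWalk x0 ω k) := by
  simp [tsetlinWalk, h]

theorem walk_missed {n t : ℕ} (x0 : Equiv.Perm (Fin n)) (ω : Fin t → Fin n) (i j : Fin n)
    (hi : ∀ s, ω s ≠ i) (hj : ∀ s, ω s ≠ j) (k : ℕ) (hk : k ≤ t) :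
    tsetlinWalk x0 ω k i < tsetlinWalk x0 ω k j ↔ x0 i < x0 j := by
  induction k with
  | zero => simp [tsetlinWalk]
  | succ k ih =>
    rw [walk_succ x0 ω k hk, mtf_lt, ih (by omega)]
    have h1 := hi ⟨k, hk⟩
    have h2 := hj ⟨k, hk⟩
    constructor
    · rintro ⟨_, h | h⟩
      · exact absurd h.symm h1
      · exact h
    · intro h; exact ⟨h2.symm, Or.inr h⟩

theorem walk_seen {n t : ℕ} (x0 y0 : Equiv.Perm (Fin n)) (ω : Fin t → Fin n) (i j : Fin n)
    (k : ℕ) (hk : k ≤ t) (h : ∃ s : Fin t, s.val < k ∧ (ω s = i ∨ ω s = j)) :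
    tsetlinWalk x0 ω k i < tsetlinWalk x0 ω k j ↔ tsetlinWalk y0 ω k i < tsetlinWalk y0 ω k j := by
  induction k with
  | zero => obtain ⟨s, hs, _⟩ := h; omega
  | succ k ih =>
    rw [walk_succ x0 ω k hk, walk_succ y0 ω k hk, mtf_lt, mtf_lt]
    by_cases hj : j = ω ⟨k, hk⟩
    · simp [hj]
    by_cases hi : i = ω ⟨k, hk⟩
    · simp [hi]
    rw [ih (by omega)]
    obtain ⟨s, hs, h⟩ := h
    refine ⟨s, ?_, h⟩
    have : s.val ≠ k := by
      intro e
      have : s = ⟨k, hk⟩ := Fin.ext e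
      subst this
      rcases h with h | h
      · exact hi h.symm
      · exact hj h.symm
    omega

theorem perm_eq_of_lt {n : ℕ} (x y : Equiv.Perm (Fin n)) (h : ∀ i j, x i < x j ↔ y i < y j) :
    x = y := by
  let e : Fin n ≃o Fin n :=
    { toEquiv := x.symm.trans y
      map_rel_iff' := by
        intro a b
        have := h (x.symm b) (x.symm a)
        simp only [Equiv.apply_symm_apply] at this
        simp only [Equiv.trans_apply]
        rw [← not_lt, ← not_lt, this] }
  ext i
  have h1 : e (x i) = x i := by
    have : e = OrderIso.refl _ := Subsingleton.elim _ _
    rw [this]; rfl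
  have h2 : e (x i) = y i := by simp [e]
  rw [← h1, h2]

/-- starting order: the reverse of `x` -/
def revOf {n : ℕ} (x : Equiv.Perm (Fin n)) : Equiv.Perm (Fin n) := x.trans Fin.revPerm

theorem walk_rev_missed {n t : ℕ} (x : Equiv.Perm (Fin n)) (ω : Fin t → Fin n)
    (hx : tsetlinWalk (revOf x) ω t = x) (i j : Fin n) (hij : i ≠ j) :
    ∃ s, ω s = i ∨ ω s = j := by
  by_contra! hc
  have h := walk_missed (revOf x) ω i j (fun s => (hc s).1) (fun s => (hc s).2) t le_rfl
  rw [hx] at h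
  simp only [revOf, Equiv.trans_apply, Fin.revPerm_apply, Fin.rev_lt_rev] at h
  have h3 : x i ≠ x j := fun e => hij (x.injective e)
  rcases lt_or_gt_of_ne h3 with h4 | h4
  · exact lt_asymm h4 (h.1 h4)
  · exact lt_asymm h4 (h.2 h4)

theorem walk_rev_unique {n t : ℕ} (x y : Equiv.Perm (Fin n)) (ω : Fin t → Fin n)
    (hx : tsetlinWalk (revOf x) ω t = x) (hy : tsetlinWalk (revOf y) ω t = y) : x = y := by
  apply perm_eq_of_lt
  intro i j
  by_cases hij : i = j
  · simp [hij]
  obtain ⟨s, hs⟩ := walk_rev_missed x ω hx i j hij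
  have := walk_seen (revOf x) (revOf y) ω i j t le_rfl ⟨s, s.2, hs⟩
  rwa [hx, hy] at this

theorem luce_eq {n : ℕ} (w : Fin n → ℝ) (τ : Equiv.Perm (Fin n)) :
    luce w τ.symm = ∏ k : Fin n, w (τ k) / ∑ m ∈ Finset.univ.filter (fun m => k ≤ m), w (τ m) := by
  unfold luce
  refine Finset.prod_congr rfl fun k _ => ?_
  rw [Equiv.symm_symm]
  congr 1
  rw [Finset.sum_filter, Finset.sum_filter, ← Equiv.sum_comp τ]
  simp

theorem luce_pos {n : ℕ} (w : Fin n → ℝ) (hw : ∀ i, 0 < w i) (σ : Equiv.Perm (Fin n)) :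
    0 < luce w σ := by
  unfold luce
  refine Finset.prod_pos fun k _ => div_pos (hw _) (Finset.sum_pos (fun i _ => hw i) ⟨σ.symm k, ?_⟩)
  simp

theorem luce_sum {n : ℕ} (w : Fin n → ℝ) (hw : ∀ i, 0 < w i) :
    ∑ τ : Equiv.Perm (Fin n), luce w τ.symm = 1 := by
  induction n with
  | zero => simp [luce]
  | succ n ih =>
    rw [← Equiv.sum_comp Equiv.Perm.decomposeFin.symm, Fintype.sum_prod_type]
    have key : ∀ (p : Fin (n+1)) (e : Equiv.Perm (Fin n)),
        luce w (Equiv.Perm.decomposeFin.symm (p, e)).symm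
          = w p / (∑ i, w i) * luce (fun j => w (Equiv.swap 0 p (Fin.succ j))) e.symm := by
      intro p e
      rw [luce_eq, luce_eq, Fin.prod_univ_succ]
      congr 1
      · simp only [Equiv.Perm.decomposeFin_symm_apply_zero, Fin.zero_le, Finset.filter_true]
        rw [Equiv.sum_comp (Equiv.Perm.decomposeFin.symm (p, e)) w]
      · refine Finset.prod_congr rfl fun k _ => ?_
        rw [Finset.sum_filter, Finset.sum_filter, Fin.sum_univ_succ]
        simp [Fin.succ_le_succ_iff]
    simp only [key]
    simp only [← Finset.mul_sum]
    have : ∀ p : Fin (n+1), ∑ e : Equiv.Perm (Fin n),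
        luce (fun j => w (Equiv.swap 0 p (Fin.succ j))) e.symm = 1 :=
      fun p => ih _ (fun j => hw _)
    simp only [this, mul_one]
    rw [← Finset.sum_div]
    exact div_self (Finset.sum_pos (fun i _ => hw i) ⟨0, by simp⟩).ne'

theorem luce_sum' {n : ℕ} (w : Fin n → ℝ) (hw : ∀ i, 0 < w i) :
    ∑ x : Equiv.Perm (Fin n), luce w x = 1 := by
  rw [← luce_sum w hw]
  exact (Equiv.sum_comp (Equiv.inv (Equiv.Perm (Fin n))) (luce w)).symm

theorem sep_bound {n : ℕ} (w : Fin n → ℝ) (hw : ∀ i, 0 < w i) (t : ℕ)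
    (g : (Fin t → Fin n) → ℝ) (hg0 : ∀ ω, 0 ≤ g ω)
    (hg1 : ∀ ω, (∀ i j, i ≠ j → ∃ s, ω s = i ∨ ω s = j) → 1 ≤ g ω) :
    1 - tsetlinSep w t ≤ ∑ ω : Fin t → Fin n, (∏ s, w (ω s)) * g ω := by
  have h1 : ∀ x : Equiv.Perm (Fin n), luce w x * (1 - tsetlinSep w t) ≤
      bookProb w t {ω | tsetlinWalk (revOf x) ω t = x} := by
    intro x
    have ha : (1 - ⨅ y : Equiv.Perm (Fin n),
      bookProb w t {ω | tsetlinWalk (revOf x) ω t = y} / luce w y) ≤ tsetlinSep w t :=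
      le_ciSup (f := fun x0 : Equiv.Perm (Fin n) => (1 - ⨅ x : Equiv.Perm (Fin n),
        bookProb w t {ω | tsetlinWalk x0 ω t = x} / luce w x)) (Set.finite_range _).bddAbove (revOf x)
    have hb := ciInf_le (f := fun y : Equiv.Perm (Fin n) =>
      bookProb w t {ω | tsetlinWalk (revOf x) ω t = y} / luce w y) (Set.finite_range _).bddBelow x
    have hc : 1 - tsetlinSep w t ≤ bookProb w t {ω | tsetlinWalk (revOf x) ω t = x} / luce w x := by
      linarith
    rw [le_div_iff₀ (luce_pos w hw x)] at hc
    linarith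
  have h2 := Finset.sum_le_sum (fun x (_ : x ∈ (Finset.univ : Finset (Equiv.Perm (Fin n)))) => h1 x)
  rw [← Finset.sum_mul, luce_sum' w hw, one_mul] at h2
  refine h2.trans ?_
  unfold bookProb
  rw [Finset.sum_comm]
  refine Finset.sum_le_sum fun ω _ => ?_
  have hW : 0 ≤ ∏ s, w (ω s) := Finset.prod_nonneg fun s _ => (hw _).le
  by_cases hex : ∃ x, tsetlinWalk (revOf x) ω t = x
  · obtain ⟨x, hx⟩ := hex
    rw [Finset.sum_eq_single x]
    · rw [Set.indicator_of_mem (by exact hx)]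
      have := hg1 ω (fun i j hij => walk_rev_missed x ω hx i j hij)
      nlinarith
    · intro y _ hy
      rw [Set.indicator_of_notMem]
      intro hy'
      exact hy (walk_rev_unique y x ω hy' hx)
    · simp
  · push Not at hex
    rw [Finset.sum_eq_zero]
    · exact mul_nonneg hW (hg0 ω)
    · intro x _
      rw [Set.indicator_of_notMem]
      exact hex x

/-- indicator that book `i` is not chosen -/
noncomputable def missInd {n t : ℕ} (i : Fin n) (ω : Fin t → Fin n) : ℝ :=
  ∏ s, if ω s = i then (0:ℝ) else 1

theorem missInd_eq {n t : ℕ} (i : Fin n) (ω : Fin t → Fin n) :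
    missInd i ω = if ∃ s, ω s = i then 0 else 1 := by
  unfold missInd
  split_ifs with h
  · obtain ⟨s, hs⟩ := h
    exact Finset.prod_eq_zero (Finset.mem_univ s) (by simp [hs])
  · push Not at h
    exact Finset.prod_eq_one fun s _ => by simp [h s]

theorem exp_one' {n : ℕ} (w : Fin n → ℝ) (hw1 : ∑ i, w i = 1) (t : ℕ) :
    ∑ ω : Fin t → Fin n, (∏ s, w (ω s)) = 1 := by
  rw [← Fintype.sum_pow, hw1, one_pow]

theorem exp_miss {n : ℕ} (w : Fin n → ℝ) (hw1 : ∑ i, w i = 1) (t : ℕ) (i : Fin n) :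
    ∑ ω : Fin t → Fin n, (∏ s, w (ω s)) * missInd i ω = (1 - w i) ^ t := by
  simp only [missInd, ← Finset.prod_mul_distrib]
  rw [← Fintype.sum_pow (fun a => w a * if a = i then (0:ℝ) else 1)]
  congr 1
  have : ∀ a, w a * (if a = i then (0:ℝ) else 1) = w a - (if a = i then w a else 0) := by
    intro a
    by_cases h1 : a = i <;> simp [h1]
  simp only [this, Finset.sum_sub_distrib, Finset.sum_ite_eq', Finset.mem_univ, if_true, hw1]

theorem exp_miss2 {n : ℕ} (w : Fin n → ℝ) (hw1 : ∑ i, w i = 1) (t : ℕ) (i j : Fin n) (hij : i ≠ j) :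
    ∑ ω : Fin t → Fin n, (∏ s, w (ω s)) * (missInd i ω * missInd j ω) = (1 - w i - w j) ^ t := by
  simp only [missInd, ← Finset.prod_mul_distrib]
  rw [← Fintype.sum_pow (fun a => w a * ((if a = i then (0:ℝ) else 1) * (if a = j then (0:ℝ) else 1)))]
  congr 1
  have : ∀ a, w a * ((if a = i then (0:ℝ) else 1) * (if a = j then (0:ℝ) else 1))
      = w a - (if a = i then w a else 0) - (if a = j then w a else 0) := by
    intro a
    by_cases h1 : a = i
    · have : a ≠ j := fun h => hij (h1.symm.trans h)
      simp [h1, hij]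
    · by_cases h2 : a = j <;> simp [h1, h2]
      intro h; exact absurd h.symm hij
  simp only [this, Finset.sum_sub_distrib, Finset.sum_ite_eq', Finset.mem_univ, if_true, hw1]

theorem pair_bound {n : ℕ} (w : Fin n → ℝ) (hw : ∀ i, 0 < w i) (hw1 : ∑ i, w i = 1) (t : ℕ)
    (i j : Fin n) (hij : i ≠ j) : (1 - w i - w j) ^ t ≤ (1 - w i) ^ t * (1 - w j) ^ t := by
  have h : w i + w j ≤ 1 := by
    rw [← hw1, ← Finset.sum_pair hij]
    exact Finset.sum_le_sum_of_subset_of_nonneg (Finset.subset_univ _) fun a _ _ => (hw a).le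
  rw [← mul_pow]
  refine pow_le_pow_left₀ (by linarith) ?_ t
  nlinarith [mul_pos (hw i) (hw j)]

theorem second_moment {n : ℕ} (w : Fin n → ℝ) (hw : ∀ i, 0 < w i) (hw1 : ∑ i, w i = 1) (t : ℕ)
    (L : Finset (Fin n)) (μ : ℝ) (hμ : μ = ∑ i ∈ L, (1 - w i) ^ t) :
    ∑ ω : Fin t → Fin n, (∏ s, w (ω s)) * (∑ i ∈ L, missInd i ω - (μ + 1)) ^ 2 ≤ μ + 1 := by
  have hle : ∀ i, w i ≤ 1 := fun i => by
    rw [← hw1]; exact Finset.single_le_sum (fun a _ => (hw a).le) (Finset.mem_univ i)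
  have e1 : ∑ ω : Fin t → Fin n, (∏ s, w (ω s)) * (∑ i ∈ L, missInd i ω) = μ := by
    simp only [Finset.mul_sum]
    rw [Finset.sum_comm, hμ]
    exact Finset.sum_congr rfl fun i _ => exp_miss w hw1 t i
  have e2 : ∑ ω : Fin t → Fin n, (∏ s, w (ω s)) * (∑ i ∈ L, missInd i ω) ^ 2 ≤ μ + μ ^ 2 := by
    have : ∀ ω : Fin t → Fin n, (∏ s, w (ω s)) * (∑ i ∈ L, missInd i ω) ^ 2
        = ∑ i ∈ L, ∑ j ∈ L, (∏ s, w (ω s)) * (missInd i ω * missInd j ω) := by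
      intro ω
      rw [sq, Finset.sum_mul_sum, Finset.mul_sum]
      simp only [Finset.mul_sum]
    simp only [this]
    rw [Finset.sum_comm]
    have h3 : ∀ i ∈ L, ∑ ω : Fin t → Fin n, ∑ j ∈ L, (∏ s, w (ω s)) * (missInd i ω * missInd j ω)
        ≤ (1 - w i) ^ t + (1 - w i) ^ t * μ := by
      intro i hi
      rw [Finset.sum_comm]
      have h4 : ∀ j ∈ L, ∑ ω : Fin t → Fin n, (∏ s, w (ω s)) * (missInd i ω * missInd j ω)
          ≤ (if j = i then (1 - w i) ^ t else 0) + (1 - w i) ^ t * (1 - w j) ^ t := by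
        intro j _
        by_cases hij : j = i
        · subst hij
          have : ∀ ω : Fin t → Fin n, missInd j ω * missInd j ω = missInd j ω := by
            intro ω; rw [missInd_eq]; split_ifs <;> simp
          simp only [this, exp_miss w hw1, if_true]
          have := mul_self_nonneg ((1 - w j) ^ t)
          linarith
        · rw [exp_miss2 w hw1 t i j (Ne.symm hij), if_neg hij, zero_add]
          exact pair_bound w hw hw1 t i j (Ne.symm hij)
      refine (Finset.sum_le_sum h4).trans ?_
      rw [Finset.sum_add_distrib, Finset.sum_ite_eq', if_pos hi, ← Finset.mul_sum, hμ]
    refine (Finset.sum_le_sum h3).trans ?_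
    rw [Finset.sum_add_distrib, ← Finset.sum_mul, ← hμ, sq]
  have e3 := exp_one' w hw1 t
  have : ∑ ω : Fin t → Fin n, (∏ s, w (ω s)) * (∑ i ∈ L, missInd i ω - (μ + 1)) ^ 2
      = ∑ ω : Fin t → Fin n, (∏ s, w (ω s)) * (∑ i ∈ L, missInd i ω) ^ 2
        - 2 * (μ + 1) * ∑ ω : Fin t → Fin n, (∏ s, w (ω s)) * (∑ i ∈ L, missInd i ω)
        + (μ + 1) ^ 2 * ∑ ω : Fin t → Fin n, (∏ s, w (ω s)) := by
    rw [Finset.mul_sum, Finset.mul_sum, ← Finset.sum_sub_distrib, ← Finset.sum_add_distrib]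
    exact Finset.sum_congr rfl fun ω _ => by ring
  rw [this, e1, e3]
  nlinarith

theorem sep_mu {n : ℕ} (w : Fin n → ℝ) (hw : ∀ i, 0 < w i) (hw1 : ∑ i, w i = 1) (t : ℕ)
    (L : Finset (Fin n)) (c : ℝ) (hc : 0 < c) (hμ : 1 + c ≤ ∑ i ∈ L, (1 - w i) ^ t) :
    1 - tsetlinSep w t ≤ 1 / c := by
  obtain ⟨μ, hμd⟩ : ∃ μ, μ = ∑ i ∈ L, (1 - w i) ^ t := ⟨_, rfl⟩
  rw [← hμd] at hμ
  have hμ0 : 0 < μ := by linarith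
  have hb := sep_bound w hw t (fun ω => (∑ i ∈ L, missInd i ω - (μ + 1)) ^ 2 / μ ^ 2)
    (fun ω => by positivity) (by
      intro ω h
      rw [le_div_iff₀ (by positivity), one_mul]
      have hM : ∑ i ∈ L, missInd i ω ≤ 1 := by
        by_cases hall : ∀ i ∈ L, missInd i ω = 0
        · rw [Finset.sum_eq_zero hall]; norm_num
        · push Not at hall
          obtain ⟨i, hi, hne⟩ := hall
          rw [missInd_eq] at hne
          rw [Finset.sum_eq_single_of_mem i hi]
          · rw [missInd_eq]; split_ifs <;> norm_num
          · intro j _ hj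
            rw [missInd_eq, if_pos]
            obtain ⟨s, hs⟩ := h i j (Ne.symm hj)
            rcases hs with hs | hs
            · exact absurd (if_pos ⟨s, hs⟩) hne
            · exact ⟨s, hs⟩
      nlinarith)
  have hs := second_moment w hw hw1 t L μ hμd
  have h3 : ∑ ω : Fin t → Fin n, (∏ s, w (ω s)) * ((∑ i ∈ L, missInd i ω - (μ + 1)) ^ 2 / μ ^ 2)
      ≤ (μ + 1) / μ ^ 2 := by
    simp only [← mul_div_assoc]
    rw [← Finset.sum_div]
    gcongr
  refine (hb.trans h3).trans ?_
  rw [div_le_div_iff₀ (by positivity) hc]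
  nlinarith

theorem sep_nonneg {n : ℕ} (w : Fin n → ℝ) (hw : ∀ i, 0 < w i) (hw1 : ∑ i, w i = 1) (t : ℕ) :
    0 ≤ tsetlinSep w t := by
  have := sep_bound w hw t (fun _ => 1) (fun _ => zero_le_one) (fun _ _ => le_rfl)
  simp only [mul_one, exp_one' w hw1] at this
  linarith

theorem light_bound (w x tstar t' : ℝ) (t : ℕ) (hw : 0 < w) (hx : 0 < x) (hxt : 2 * x < tstar)
    (hT : t' = tstar - 3 / 2 * x) (ht : (t : ℝ) ≤ t' - x / 2) (hl : w ≤ x / (2 * tstar)) :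
    Real.exp (-(w * t')) ≤ (1 - w) ^ t := by
  have hts : 0 < tstar := by linarith
  rw [le_div_iff₀ (by positivity)] at hl
  have hw1 : w < 1 := by nlinarith
  have h1w : 0 < 1 - w := by linarith
  have h1 : Real.exp (-(w / (1 - w))) ≤ 1 - w := by
    rw [Real.exp_neg]
    have h := Real.add_one_le_exp (w / (1 - w))
    have h2 : w / (1 - w) + 1 = (1 - w)⁻¹ := by field_simp; ring
    rw [h2] at h
    exact inv_le_of_inv_le₀ h1w h
  have h2 := pow_le_pow_left₀ (Real.exp_pos _).le h1 t
  refine le_trans ?_ h2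
  rw [← Real.exp_nat_mul, Real.exp_le_exp]
  have h3 : (t : ℝ) * (w / (1 - w)) ≤ w * t' := by
    rw [← mul_div_assoc, div_le_iff₀ h1w]
    have : (t : ℝ) ≤ t' * (1 - w) := by nlinarith
    nlinarith
  linarith

theorem heavy_num (x : ℝ) (hx : 6 ≤ x) : x * Real.exp (-(x / 2)) ≤ 3 / 10 := by
  have h1 : Real.exp 1 * (x / 6) ≤ Real.exp (x / 6) := by
    have := Real.add_one_le_exp (x / 6 - 1)
    have h2 : Real.exp (x / 6) = Real.exp 1 * Real.exp (x / 6 - 1) := by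
      rw [← Real.exp_add]; congr 1; ring
    rw [h2]
    exact mul_le_mul_of_nonneg_left (by linarith) (Real.exp_pos _).le
  have h2 : (2.718 * (x / 6)) ≤ Real.exp (x / 6) := by
    have := Real.exp_one_gt_d9
    nlinarith
  have h3 := pow_le_pow_left₀ (by positivity) h2 3
  rw [← Real.exp_nat_mul] at h3
  have h4 : ((3 : ℕ) : ℝ) * (x / 6) = x / 2 := by push_cast; ring
  rw [h4] at h3
  rw [Real.exp_neg, ← div_eq_mul_inv, div_le_iff₀ (Real.exp_pos _)]
  have h5 : (2.718 * (x / 6)) ^ 3 = (2.718 / 6) ^ 3 * (x ^ 2 * x) := by ring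
  rw [h5] at h3
  have h6 : 36 * x ≤ x ^ 2 * x := by nlinarith
  norm_num at h3
  nlinarith

theorem final_num (c : ℝ) (hc : 1 < c) (l : ℝ) (hl : 1 / 2 - 1 / 5 * ((c - 1) / c) ≤ l) :
    1 + c ≤ l * Real.exp (3 / 2 * c) := by
  obtain ⟨s, rfl⟩ : ∃ s, c = 1 + s := ⟨c - 1, by ring⟩
  have hs : 0 < s := by linarith
  have h1 : (448 / 100 : ℝ) ≤ Real.exp (3 / 2) := by
    have h := Real.exp_one_gt_d9
    have h2 : Real.exp (3 / 2) ^ 2 = Real.exp 1 ^ 3 := by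
      rw [← Real.exp_nat_mul, ← Real.exp_nat_mul]; norm_num
    have h3 : (2.718 : ℝ) ^ 3 ≤ Real.exp 1 ^ 3 := pow_le_pow_left₀ (by norm_num) (by linarith) 3
    rw [← h2] at h3
    refine (sq_le_sq₀ (by norm_num) (Real.exp_pos _).le).1 ?_
    norm_num at h3 ⊢
    linarith
  have h2 : 1 + 3 / 2 * s + (3 / 2 * s) ^ 2 / 2 ≤ Real.exp (3 / 2 * s) :=
    Real.quadratic_le_exp_of_nonneg (by positivity)
  have h3 : (448 / 100 : ℝ) * (1 + 3 / 2 * s + (3 / 2 * s) ^ 2 / 2) ≤ Real.exp (3 / 2 * (1 + s)) := by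
    rw [mul_add (3 / 2 : ℝ) 1 s, mul_one, Real.exp_add]
    exact mul_le_mul h1 h2 (by positivity) (Real.exp_pos _).le
  have h4 : 1 / 2 - 1 / 5 * ((1 + s - 1) / (1 + s)) = (1 / 2 + 3 / 10 * s) / (1 + s) := by
    field_simp; ring
  rw [h4] at hl
  have h5 : (1 / 2 + 3 / 10 * s) / (1 + s) * ((448 / 100 : ℝ) * (1 + 3 / 2 * s + (3 / 2 * s) ^ 2 / 2))
      ≤ l * Real.exp (3 / 2 * (1 + s)) := by
    have : 0 ≤ (1 / 2 + 3 / 10 * s) / (1 + s) := by positivity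
    exact mul_le_mul hl h3 (by positivity) (this.trans hl)
  refine le_trans ?_ h5
  rw [div_mul_eq_mul_div, le_div_iff₀ (by positivity)]
  nlinarith [pow_pos hs 2, pow_pos hs 3]

/-- Lower bound for the separation distance of the Tsetlin library: with
`t_*` solving `∑ i, exp (−w i t_*) = 1/2` and `w_min = min_i w i`, for every
`0 < c < t_* w_min / 2` and every integer `t ≤ t_* − 2c / w_min`,
`s(t) ≥ 1 − e^{−e^{c/2}/2} − (4 w_min² t_* − 2 c w_min) / c² − 1/c`. -/
theorem tsetlin_separation_lower {n : ℕ} (w : Fin n → ℝ)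
    (hw0 : ∀ i, 0 < w i) (hw1 : ∑ i, w i = 1)
    (tstar : ℝ) (htstar0 : 0 < tstar)
    (htstar : ∑ i, Real.exp (-(w i * tstar)) = 1 / 2)
    (wmin : ℝ) (hwmin : IsLeast (Set.range w) wmin)
    (c : ℝ) (hc0 : 0 < c) (hc1 : c < tstar * wmin / 2)
    (t : ℕ) (ht : (t : ℝ) ≤ tstar - 2 * c / wmin) :
    tsetlinSep w t
      ≥ 1 - Real.exp (-(Real.exp (c / 2)) / 2)
        - (4 * wmin ^ 2 * tstar - 2 * c * wmin) / c ^ 2 - 1 / c := by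
  have hwm : ∀ i, wmin ≤ w i := fun i => hwmin.2 ⟨i, rfl⟩
  have hm0 : 0 < wmin := by obtain ⟨i, hi⟩ := hwmin.1; rw [← hi]; exact hw0 i
  have hnn := sep_nonneg w hw0 hw1 t
  have hexp := Real.exp_pos (-(Real.exp (c / 2)) / 2)
  by_cases htriv : 1 ≤ (4 * wmin ^ 2 * tstar - 2 * c * wmin) / c ^ 2 + 1 / c
  · linarith
  push Not at htriv
  have hK : 6 * c * wmin ≤ 4 * wmin ^ 2 * tstar - 2 * c * wmin := by nlinarith
  have hK2 : 3 * wmin ^ 2 * tstar ≤ 4 * wmin ^ 2 * tstar - 2 * c * wmin := by nlinarith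
  have htriv2 : 4 * wmin ^ 2 * tstar - 2 * c * wmin + c < c ^ 2 := by
    have h : (4 * wmin ^ 2 * tstar - 2 * c * wmin) / c ^ 2 + 1 / c
      = (4 * wmin ^ 2 * tstar - 2 * c * wmin + c) / c ^ 2 := by field_simp
    rw [h, div_lt_one (by positivity)] at htriv
    exact htriv
  have hK0 : 0 < 6 * c * wmin := by positivity
  have hcc : 1 < c := by nlinarith
  obtain ⟨x, hx⟩ : ∃ x, x = c / wmin := ⟨_, rfl⟩
  have hx0 : 0 < x := by rw [hx]; positivity
  have hcx : c = x * wmin := by rw [hx]; field_simp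
  have hxt : 2 * x < tstar := by
    rw [hcx] at hc1
    have : x * wmin < (tstar / 2) * wmin := by linarith
    have := lt_of_mul_lt_mul_right this hm0.le
    linarith
  have ht2 : (t : ℝ) ≤ (tstar - 3 / 2 * x) - x / 2 := by
    have : 2 * c / wmin = 2 * x := by rw [hx]; ring
    linarith
  -- `6 ≤ x`
  have hx6 : 6 ≤ x := by
    have h1 : 6 * wmin < c := by nlinarith
    rw [hx, le_div_iff₀ hm0]; exact h1.le
  obtain ⟨θ, hθ⟩ : ∃ θ, θ = x / (2 * tstar) := ⟨_, rfl⟩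
  have hθ0 : 0 < θ := by rw [hθ]; positivity
  have hθt : θ * tstar = x / 2 := by rw [hθ]; field_simp
  have hheavy : ∑ i ∈ Finset.univ.filter (fun i => ¬ w i ≤ θ), Real.exp (-(w i * tstar))
      ≤ 1 / 5 * ((c - 1) / c) := by
    have h1 : ∑ i ∈ Finset.univ.filter (fun i => ¬ w i ≤ θ), Real.exp (-(w i * tstar))
        ≤ ∑ i, w i / θ * Real.exp (-(x / 2)) := by
      refine (Finset.sum_le_sum (g := fun i => w i / θ * Real.exp (-(x / 2))) ?_).trans
        (Finset.sum_le_sum_of_subset_of_nonneg (Finset.subset_univ _) ?_)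
      · intro i hi
        simp only [Finset.mem_filter, Finset.mem_univ, true_and, not_le] at hi
        have ha : Real.exp (-(w i * tstar)) ≤ Real.exp (-(x / 2)) := by
          rw [Real.exp_le_exp]; nlinarith
        have hb : 1 ≤ w i / θ := by rw [le_div_iff₀ hθ0]; linarith
        nlinarith [Real.exp_pos (-(x / 2))]
      · intro i _ _
        have := hw0 i
        positivity
    refine h1.trans ?_
    rw [← Finset.sum_mul, ← Finset.sum_div, hw1]
    have h2 : 1 / θ ≤ 2 / 3 * x * ((c - 1) / c) := by
      have e1 : 1 / θ = 2 * tstar / x := by rw [hθ]; field_simp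
      have e2 : 2 / 3 * x * ((c - 1) / c) = 2 / 3 * (c - 1) / wmin := by rw [hx]; field_simp
      rw [e1, e2, div_le_div_iff₀ hx0 hm0]
      have h3 : 3 * wmin ^ 2 * tstar ≤ c ^ 2 - c := by linarith
      have h4 : (3 * wmin * tstar) * wmin ≤ ((c - 1) * x) * wmin := by
        have : ((c - 1) * x) * wmin = c ^ 2 - c := by
          rw [mul_assoc, ← hcx]; ring
        rw [this]; linarith
      have := le_of_mul_le_mul_right h4 hm0
      linarith
    have h3 := heavy_num x hx6
    have hr : 0 ≤ (c - 1) / c := div_nonneg (by linarith) hc0.le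
    calc 1 / θ * Real.exp (-(x / 2)) ≤ 2 / 3 * x * ((c - 1) / c) * Real.exp (-(x / 2)) :=
          mul_le_mul_of_nonneg_right h2 (Real.exp_pos _).le
      _ = 2 / 3 * ((c - 1) / c) * (x * Real.exp (-(x / 2))) := by ring
      _ ≤ 2 / 3 * ((c - 1) / c) * (3 / 10) := mul_le_mul_of_nonneg_left h3 (by positivity)
      _ = _ := by ring
  have hsplit := Finset.sum_filter_add_sum_filter_not Finset.univ (fun i => w i ≤ θ)
    (fun i => Real.exp (-(w i * tstar)))
  rw [htstar] at hsplit
  have hlight : 1 / 2 - 1 / 5 * ((c - 1) / c)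
      ≤ ∑ i ∈ Finset.univ.filter (fun i => w i ≤ θ), Real.exp (-(w i * tstar)) := by linarith
  have hfin := final_num c hcc _ hlight
  have hμ : 1 + c ≤ ∑ i ∈ Finset.univ.filter (fun i => w i ≤ θ), (1 - w i) ^ t := by
    refine hfin.trans ?_
    rw [Finset.sum_mul]
    refine Finset.sum_le_sum fun i hi => ?_
    simp only [Finset.mem_filter, Finset.mem_univ, true_and] at hi
    refine le_trans ?_ (light_bound (w i) x tstar _ t (hw0 i) hx0 hxt rfl ht2 (hθ ▸ hi))
    rw [← Real.exp_add, Real.exp_le_exp]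
    have : c ≤ w i * x := by
      rw [hcx, mul_comm]; exact mul_le_mul_of_nonneg_right (hwm i) hx0.le
    nlinarith
  have hs := sep_mu w hw0 hw1 t _ c hc0 hμ
  have hpos : 0 ≤ (4 * wmin ^ 2 * tstar - 2 * c * wmin) / c ^ 2 := by
    apply div_nonneg _ (by positivity); linarith
  linarith
end

section
/- For the weighted nearest-neighbor walk on the hypercube {−,+}^n with positive weights satisfying w_i^+ = w_i^− for all i, the stationary distribution is uniform on {−,+}^n and the separation distance satisfies s(t) = P(T > t) for every t ∈ ℕ, where T is the first time every coordinate index has been picked. -/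
open Finset

/-- The weighted nearest-neighbor walk on the hypercube `{−,+}^n` (coded as
`Fin n → Bool`) after `k` steps started from `x0`: at each step a pair
`(i, ε)` is drawn and the `i`-th coordinate is set to `ε`. -/
def cubeWalk {n t : ℕ} (x0 : Fin n → Bool) (ω : Fin t → Fin n × Bool) :
    ℕ → (Fin n → Bool)
  | 0 => x0
  | k + 1 => if h : k < t then
      Function.update (cubeWalk x0 ω k) (ω ⟨k, h⟩).1 (ω ⟨k, h⟩).2
    else cubeWalk x0 ω k

/-- Probability of an event depending on the first `t` i.i.d. draws of pairs
`(coordinate, sign)` with law `w`. -/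
noncomputable def cubeProb {n : ℕ} (w : Fin n × Bool → ℝ) (t : ℕ)
    (E : Set (Fin t → Fin n × Bool)) : ℝ :=
  ∑ ω : Fin t → Fin n × Bool, Set.indicator E (fun ω => ∏ s, w (ω s)) ω


lemma w_eq_of_fst {n : ℕ} (w : Fin n × Bool → ℝ)
    (hsym : ∀ i : Fin n, w (i, true) = w (i, false)) (i : Fin n) (a b : Bool) :
    w (i, a) = w (i, b) := by
  cases a <;> cases b <;> simp [hsym]

lemma stationary_aux {n : ℕ} (w : Fin n × Bool → ℝ) (hw1 : ∑ d, w d = 1)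
    (hsym : ∀ i : Fin n, w (i, true) = w (i, false)) (x : Fin n → Bool) :
    ∑ y : Fin n → Bool, (∑ d : Fin n × Bool,
      if Function.update y d.1 d.2 = x then w d else 0) = 1 := by
  rw [← Fintype.sum_prod_type'
    (f := fun (y : Fin n → Bool) (d : Fin n × Bool) =>
      if Function.update y d.1 d.2 = x then w d else 0)]
  have hinv : Function.Involutive (fun p : (Fin n → Bool) × (Fin n × Bool) =>
      (Function.update p.1 p.2.1 p.2.2, (p.2.1, p.1 p.2.1))) := by
    rintro ⟨y, i, e⟩
    simp
  rw [← Equiv.sum_comp (Function.Involutive.toPerm _ hinv)]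
  have : ∀ p : (Fin n → Bool) × (Fin n × Bool),
      (if Function.update ((Function.Involutive.toPerm _ hinv) p).1 ((Function.Involutive.toPerm _ hinv) p).2.1 ((Function.Involutive.toPerm _ hinv) p).2.2 = x
        then w ((Function.Involutive.toPerm _ hinv) p).2 else 0) = if p.1 = x then w p.2 else 0 := by
    rintro ⟨y, i, e⟩
    simp [w_eq_of_fst w hsym i (y i) e]
  rw [Finset.sum_congr rfl (fun p _ => this p), Fintype.sum_prod_type, Finset.sum_comm]
  simp [hw1]

/-- Flip the signs of all draws according to the pattern `z`. -/
def flipDraw {n t : ℕ} (z : Fin n → Bool) (ω : Fin t → Fin n × Bool) :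
    Fin t → Fin n × Bool := fun s => ((ω s).1, xor (ω s).2 (z (ω s).1))

lemma flipDraw_invol {n t : ℕ} (z : Fin n → Bool) :
    Function.Involutive (flipDraw (t := t) z) := by
  intro ω
  funext s
  simp [flipDraw]

lemma walk_not_picked {n t : ℕ} (x0 : Fin n → Bool) (ω : Fin t → Fin n × Bool) (i : Fin n)
    (h : ∀ s, (ω s).1 ≠ i) (k : ℕ) : cubeWalk x0 ω k i = x0 i := by
  induction k with
  | zero => rfl
  | succ k ih =>
    rw [cubeWalk]
    split_ifs with hk
    · rw [Function.update_of_ne (h _).symm, ih]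
    · exact ih

lemma walk_flip {n t : ℕ} (x0 z : Fin n → Bool) (ω : Fin t → Fin n × Bool) (i : Fin n)
    (k : ℕ) (h : ∃ s : Fin t, s.1 < k ∧ (ω s).1 = i) :
    cubeWalk x0 (flipDraw z ω) k i = xor (cubeWalk x0 ω k i) (z i) := by
  induction k with
  | zero => obtain ⟨s, hs, _⟩ := h; omega
  | succ k ih =>
    rw [cubeWalk, cubeWalk]
    split_ifs with hk
    · by_cases hi : (ω ⟨k, hk⟩).1 = i
      · subst hi
        simp [flipDraw]
      · have hi' : i ≠ (flipDraw z ω ⟨k, hk⟩).1 := fun e => hi e.symm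
        rw [Function.update_of_ne hi', Function.update_of_ne (Ne.symm hi)]
        apply ih
        obtain ⟨s, hs, hsi⟩ := h
        refine ⟨s, ?_, hsi⟩
        rcases Nat.lt_succ_iff_lt_or_eq.mp hs with h1 | h1
        · exact h1
        · exfalso
          apply hi
          rw [← hsi]
          congr 2
          exact Fin.ext h1.symm
    · apply ih
      obtain ⟨s, hs, hsi⟩ := h
      exact ⟨s, by have := s.2; omega, hsi⟩

lemma cubeProb_mono {n : ℕ} (w : Fin n × Bool → ℝ) (hw0 : ∀ d, 0 < w d) (t : ℕ)
    {A B : Set (Fin t → Fin n × Bool)} (h : A ⊆ B) : cubeProb w t A ≤ cubeProb w t B := by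
  unfold cubeProb
  apply Finset.sum_le_sum
  intro ω _
  exact Set.indicator_le_indicator_of_subset h
    (fun ω => Finset.prod_nonneg fun s _ => (hw0 _).le) ω

lemma cubeProb_univ {n : ℕ} (w : Fin n × Bool → ℝ) (hw1 : ∑ d, w d = 1) (t : ℕ) :
    cubeProb w t Set.univ = 1 := by
  unfold cubeProb
  simp only [Set.indicator_univ]
  rw [← Fintype.prod_sum (f := fun (_ : Fin t) d => w d)]
  simp [hw1]

lemma cubeProb_compl {n : ℕ} (w : Fin n × Bool → ℝ) (hw1 : ∑ d, w d = 1) (t : ℕ)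
    (A : Set (Fin t → Fin n × Bool)) : cubeProb w t A = 1 - cubeProb w t Aᶜ := by
  rw [← cubeProb_univ w hw1 t, eq_sub_iff_add_eq]
  unfold cubeProb
  rw [← Finset.sum_add_distrib]
  apply Finset.sum_congr rfl
  intro ω _
  rw [Set.indicator_univ]
  exact congrFun (Set.indicator_self_add_compl A _) ω

lemma cubeProb_flip {n : ℕ} (w : Fin n × Bool → ℝ)
    (hsym : ∀ i : Fin n, w (i, true) = w (i, false)) (t : ℕ) (z : Fin n → Bool)
    (A : Set (Fin t → Fin n × Bool)) :
    cubeProb w t (flipDraw z ⁻¹' A) = cubeProb w t A := by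
  unfold cubeProb
  rw [← Equiv.sum_comp (flipDraw_invol (t := t) z).toPerm (fun ω => A.indicator _ ω)]
  apply Finset.sum_congr rfl
  intro ω _
  have hp : ∏ s, w (flipDraw z ω s) = ∏ s, w (ω s) :=
    Finset.prod_congr rfl fun s _ => w_eq_of_fst w hsym (ω s).1 _ (ω s).2
  by_cases h : flipDraw z ω ∈ A
  · have h' : ω ∈ flipDraw z ⁻¹' A := h
    simp [h, hp]
  · simp [h]

/-- All indices have been picked. -/
def covered (n t : ℕ) : Set (Fin t → Fin n × Bool) := {ω | ∃ i : Fin n, ∀ s, (ω s).1 ≠ i}ᶜ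

lemma mem_covered {n t : ℕ} (ω : Fin t → Fin n × Bool) :
    ω ∈ covered n t ↔ ∀ i, ∃ s, (ω s).1 = i := by
  simp [covered]

lemma covered_walk {n : ℕ} (w : Fin n × Bool → ℝ)
    (hsym : ∀ i : Fin n, w (i, true) = w (i, false)) (t : ℕ) (x0 x : Fin n → Bool) :
    cubeProb w t (covered n t ∩ {ω | cubeWalk x0 ω t = x}) * 2 ^ n
      = cubeProb w t (covered n t) := by
  have hconst : ∀ y, cubeProb w t (covered n t ∩ {ω | cubeWalk x0 ω t = y})
      = cubeProb w t (covered n t ∩ {ω | cubeWalk x0 ω t = x}) := by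
    intro y
    rw [← cubeProb_flip w hsym t (fun i => xor (x i) (y i))]
    congr 1
    ext ω
    have hc : flipDraw (fun i => xor (x i) (y i)) ω ∈ covered n t ↔ ω ∈ covered n t := by
      simp [mem_covered, flipDraw]
    simp only [Set.mem_preimage, Set.mem_inter_iff, hc, Set.mem_ofPred_eq]
    apply and_congr_right
    intro hω
    rw [mem_covered] at hω
    rw [funext_iff, funext_iff]
    apply forall_congr'
    intro i
    obtain ⟨s, hs⟩ := hω i
    rw [walk_flip x0 _ ω i t ⟨s, s.2, hs⟩]
    cases cubeWalk x0 ω t i <;> cases x i <;> cases y i <;> simp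
  have hsum : ∑ y, cubeProb w t (covered n t ∩ {ω | cubeWalk x0 ω t = y})
      = cubeProb w t (covered n t) := by
    unfold cubeProb
    rw [Finset.sum_comm]
    apply Finset.sum_congr rfl
    intro ω _
    classical
    simp only [Set.indicator_apply, Set.mem_inter_iff, Set.mem_ofPred_eq]
    by_cases h : ω ∈ covered n t <;> simp [h]
  rw [← hsum, Finset.sum_congr rfl (fun y _ => hconst y)]
  simp [mul_comm]

/-- For the weighted nearest-neighbor walk on the hypercube with `w i + = w i −` for all
`i`, the uniform distribution is stationary and the separation distance satisfies
`s(t) = P(T > t)`, where `T` is the first time every coordinate index has been picked. -/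
theorem cube_uniform_stationary_and_separation_eq_tail {n : ℕ}
    (w : Fin n × Bool → ℝ) (hw0 : ∀ d, 0 < w d) (hw1 : ∑ d, w d = 1)
    (hsym : ∀ i : Fin n, w (i, true) = w (i, false)) :
    (∀ x : Fin n → Bool,
      ∑ y : Fin n → Bool, ((1 : ℝ) / 2 ^ n) *
        (∑ d : Fin n × Bool, if Function.update y d.1 d.2 = x then w d else 0)
      = (1 : ℝ) / 2 ^ n) ∧
    (∀ t : ℕ,
      (⨆ x0 : Fin n → Bool, (1 - ⨅ x : Fin n → Bool,
          cubeProb w t {ω | cubeWalk x0 ω t = x} / ((1 : ℝ) / 2 ^ n)))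
        = cubeProb w t {ω | ∃ i : Fin n, ∀ s, (ω s).1 ≠ i}) := by
  refine ⟨fun x => ?_, fun t => ?_⟩
  · rw [← Finset.mul_sum, stationary_aux w hw1 hsym x, mul_one]
  · have key : ∀ x0 : Fin n → Bool, (⨅ x : Fin n → Bool,
        cubeProb w t {ω | cubeWalk x0 ω t = x} / ((1 : ℝ) / 2 ^ n))
        = cubeProb w t (covered n t) := by
      intro x0
      apply le_antisymm
      · refine (ciInf_le (Set.finite_range _).bddBelow (fun i => !(x0 i))).trans ?_
        rw [div_div_eq_mul_div, div_one, ← covered_walk w hsym t x0 (fun i => !(x0 i))]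
        apply mul_le_mul_of_nonneg_right _ (by positivity)
        apply cubeProb_mono w hw0
        intro ω hω
        refine ⟨?_, hω⟩
        rintro ⟨i, hi⟩
        have h1 := walk_not_picked x0 ω i hi t
        have h2 : cubeWalk x0 ω t i = !(x0 i) := congrFun hω i
        rw [h1] at h2
        cases h3 : x0 i <;> simp [h3] at h2
      · apply le_ciInf
        intro x
        rw [div_div_eq_mul_div, div_one, ← covered_walk w hsym t x0 x]
        apply mul_le_mul_of_nonneg_right _ (by positivity)
        exact cubeProb_mono w hw0 t Set.inter_subset_right
    simp only [key]
    rw [ciSup_const, cubeProb_compl w hw1 t {ω | ∃ i : Fin n, ∀ s, (ω s).1 ≠ i}]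
    rfl
end

section
/- For the weighted nearest-neighbor walk on the hypercube {−,+}^n with arbitrary positive weights w_i^±, every starting state x_0, every t ∈ ℕ with P(T ≤ t) > 0, and every x ∈ {−,+}^n: P(C^t_{x_0} = x | T ≤ t) = ∏_{i=1}^n w_i^{x(i)} / (w_i^+ + w_i^−), where x(i) ∈ {+,−} is the i-th coordinate of x. -/
open Finset

theorem cubeWalk_snoc {n t : ℕ} (x0 : Fin n → Bool) (ω : Fin t → Fin n × Bool)
    (d : Fin n × Bool) (k : ℕ) (hk : k ≤ t) :
    cubeWalk x0 (Fin.snoc ω d : Fin (t + 1) → Fin n × Bool) k = cubeWalk x0 ω k := by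
  induction k with
  | zero => rfl
  | succ k ih =>
    have h1 : k < t := hk
    have h2 : k < t + 1 := by omega
    have h3 : (Fin.snoc ω d : Fin (t + 1) → Fin n × Bool) ⟨k, h2⟩ = ω ⟨k, h1⟩ := by
      have : (⟨k, h2⟩ : Fin (t + 1)) = Fin.castSucc ⟨k, h1⟩ := rfl
      rw [this]
      exact Fin.snoc_castSucc (α := fun _ => Fin n × Bool) d ω ⟨k, h1⟩
    simp only [cubeWalk, dif_pos h1, dif_pos h2, ih h1.le, h3]

theorem cubeWalk_snoc_last {n t : ℕ} (x0 : Fin n → Bool) (ω : Fin t → Fin n × Bool)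
    (d : Fin n × Bool) :
    cubeWalk x0 (Fin.snoc ω d : Fin (t + 1) → Fin n × Bool) (t + 1)
      = Function.update (cubeWalk x0 ω t) d.1 d.2 := by
  have h2 : t < t + 1 := by omega
  have h3 : (Fin.snoc ω d : Fin (t + 1) → Fin n × Bool) ⟨t, h2⟩ = d :=
    Fin.snoc_last (α := fun _ => Fin n × Bool) d ω
  rw [cubeWalk, dif_pos h2, h3, cubeWalk_snoc x0 ω d t le_rfl]

theorem cubeProb_succ {n t : ℕ} (w : Fin n × Bool → ℝ)
    (E : Set (Fin (t + 1) → Fin n × Bool)) :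
    cubeProb w (t + 1) E
      = ∑ d, w d * cubeProb w t {ω | (Fin.snoc ω d : Fin (t + 1) → Fin n × Bool) ∈ E} := by
  classical
  unfold cubeProb
  rw [← (Fin.snocEquiv (fun _ : Fin (t + 1) => Fin n × Bool)).sum_comp, Fintype.sum_prod_type]
  refine Finset.sum_congr rfl fun d _ => ?_
  rw [Finset.mul_sum]
  refine Finset.sum_congr rfl fun ω _ => ?_
  have he : (Fin.snocEquiv (fun _ : Fin (t + 1) => Fin n × Bool)) (d, ω)
      = (Fin.snoc ω d : Fin (t + 1) → Fin n × Bool) := rfl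
  rw [he]
  simp only [Set.indicator_apply, Set.mem_ofPred_eq]
  split_ifs
  · rw [Fin.prod_univ_castSucc]
    simp [mul_comm]
  · simp

/-- all coordinates in `S` picked -/
def covS {n : ℕ} (t : ℕ) (S : Finset (Fin n)) : Set (Fin t → Fin n × Bool) :=
  {ω | ∀ i ∈ S, ∃ s, (ω s).1 = i}

/-- the walk agrees with `x` on `S` -/
def agrS {n : ℕ} (x0 x : Fin n → Bool) (t : ℕ) (S : Finset (Fin n)) :
    Set (Fin t → Fin n × Bool) :=
  {ω | ∀ i ∈ S, cubeWalk x0 ω t i = x i}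

theorem snoc_mem_covS {n t : ℕ} (S : Finset (Fin n)) (ω : Fin t → Fin n × Bool)
    (d : Fin n × Bool) :
    (Fin.snoc ω d : Fin (t + 1) → Fin n × Bool) ∈ covS (t + 1) S
      ↔ ω ∈ covS t (S.erase d.1) := by
  simp only [covS, Set.mem_ofPred_eq, Fin.exists_fin_succ', Fin.snoc_castSucc, Fin.snoc_last,
    Finset.mem_erase]
  grind

theorem snoc_mem_agrS {n t : ℕ} (x0 x : Fin n → Bool) (S : Finset (Fin n))
    (ω : Fin t → Fin n × Bool) (d : Fin n × Bool) :
    (Fin.snoc ω d : Fin (t + 1) → Fin n × Bool) ∈ agrS x0 x (t + 1) S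
      ↔ (d.1 ∈ S → d.2 = x d.1) ∧ ω ∈ agrS x0 x t (S.erase d.1) := by
  simp only [agrS, Set.mem_ofPred_eq, cubeWalk_snoc_last, Function.update_apply, Finset.mem_erase]
  grind

theorem cube_main {n : ℕ} (w : Fin n × Bool → ℝ) (hw0 : ∀ d, 0 < w d)
    (x0 x : Fin n → Bool) (t : ℕ) : ∀ S : Finset (Fin n),
    cubeProb w t (agrS x0 x t S ∩ covS t S)
      = (∏ i ∈ S, w (i, x i) / (w (i, true) + w (i, false))) * cubeProb w t (covS t S) := by
  classical
  induction t with
  | zero =>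
    intro S
    rcases S.eq_empty_or_nonempty with rfl | ⟨i, hi⟩
    · simp [agrS, covS]
    · have : (covS 0 S : Set (Fin 0 → Fin n × Bool)) = ∅ := by
        ext ω
        simp only [covS, Set.mem_ofPred_eq, Set.mem_empty_iff_false, iff_false]
        intro h
        obtain ⟨s, _⟩ := h i hi
        exact s.elim0
      simp [this, cubeProb]
  | succ t ih =>
    intro S
    rw [cubeProb_succ, cubeProb_succ, Fintype.sum_prod_type, Fintype.sum_prod_type,
      Finset.mul_sum]
    refine Finset.sum_congr rfl fun j _ => ?_
    have hc : ∀ e : Bool, {ω : Fin t → Fin n × Bool |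
        (Fin.snoc ω (j, e) : Fin (t + 1) → Fin n × Bool) ∈ covS (t + 1) S}
        = covS t (S.erase j) := fun e => by
      ext ω; exact snoc_mem_covS S ω (j, e)
    have ha : ∀ e : Bool, cubeProb w t {ω : Fin t → Fin n × Bool |
        (Fin.snoc ω (j, e) : Fin (t + 1) → Fin n × Bool) ∈
          agrS x0 x (t + 1) S ∩ covS (t + 1) S}
        = if (j ∈ S → e = x j) then
          (∏ i ∈ S.erase j, w (i, x i) / (w (i, true) + w (i, false)))
            * cubeProb w t (covS t (S.erase j)) else 0 := fun e => by
      rw [← ih]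
      split_ifs with h
      · congr 1
        ext ω
        simp only [Set.mem_ofPred_eq, Set.mem_inter_iff, snoc_mem_covS, snoc_mem_agrS]
        tauto
      · have : {ω : Fin t → Fin n × Bool |
          (Fin.snoc ω (j, e) : Fin (t + 1) → Fin n × Bool) ∈
            agrS x0 x (t + 1) S ∩ covS (t + 1) S} = ∅ := by
          ext ω
          simp only [Set.mem_ofPred_eq, Set.mem_inter_iff, snoc_mem_covS, snoc_mem_agrS,
            Set.mem_empty_iff_false]
          tauto
        rw [this]
        simp [cubeProb]
    simp only [hc, ha, Fintype.sum_bool]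
    by_cases hj : j ∈ S
    · rw [← Finset.mul_prod_erase S _ hj]
      have hW : w (j, true) + w (j, false) ≠ 0 := (add_pos (hw0 _) (hw0 _)).ne'
      cases hx : x j <;> simp [hj] <;> field_simp
    · simp [hj, Finset.erase_eq_of_notMem hj]
      ring

theorem cube_conditional_product {n : ℕ}
    (w : Fin n × Bool → ℝ) (hw0 : ∀ d, 0 < w d) (hw1 : ∑ d, w d = 1)
    (x0 : Fin n → Bool) (t : ℕ)
    (hpos : 0 < cubeProb w t {ω | ∀ i : Fin n, ∃ s, (ω s).1 = i})
    (x : Fin n → Bool) :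
    cubeProb w t ({ω | cubeWalk x0 ω t = x} ∩ {ω | ∀ i : Fin n, ∃ s, (ω s).1 = i})
        / cubeProb w t {ω | ∀ i : Fin n, ∃ s, (ω s).1 = i}
      = ∏ i : Fin n, w (i, x i) / (w (i, true) + w (i, false)) := by
  have h := cube_main w hw0 x0 x t Finset.univ
  have h1 : (covS t Finset.univ : Set (Fin t → Fin n × Bool))
      = {ω | ∀ i : Fin n, ∃ s, (ω s).1 = i} := by
    ext ω; simp [covS]
  have h2 : (agrS x0 x t Finset.univ : Set (Fin t → Fin n × Bool))
      = {ω | cubeWalk x0 ω t = x} := by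
    ext ω; simp [agrS, funext_iff]
  rw [h1, h2] at h
  rw [h, mul_div_assoc, div_self hpos.ne', mul_one]
end

section
/- Let (Ω = S^V, π) be a monotone system and run the Glauber dynamics started from the top configuration ⊤ (every site at the maximum spin). Let ⊥ be the bottom configuration (every site at the minimum spin) and T the first time every site has been selected. Then for every t ∈ ℕ with P(T ≤ t) > 0, P(X^t = ⊥ | X^0 = ⊤, T ≤ t) ≤ π(⊥). -/
open Finset

/-- The probability that the Glauber dynamics at configuration `σ`, having selected the
site `u`, updates the spin at `u` to `s`. -/
noncomputable def updProb {V S : Type*} [Fintype S] [DecidableEq V] (π : (V → S) → ℝ)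
    (σ : V → S) (u : V) (s : S) : ℝ :=
  π (Function.update σ u s) / ∑ s' : S, π (Function.update σ u s')

/-- The weight of a trajectory `X` of the random-scan Glauber dynamics driven by the
sequence `u` of selected sites: at each step a uniform site is selected and its spin is
resampled from the conditional distribution. -/
noncomputable def trajWeight {V S : Type*} [Fintype V] [Fintype S] [DecidableEq V]
    [DecidableEq S] (π : (V → S) → ℝ) {t : ℕ} (u : Fin t → V)
    (X : Fin (t + 1) → V → S) : ℝ :=
  ∏ k : Fin t, (1 / (Fintype.card V : ℝ)) *
    (if X k.succ = Function.update (X k.castSucc) (u k) (X k.succ (u k))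
      then updProb π (X k.castSucc) (u k) (X k.succ (u k)) else 0)

/-- The probability of an event on pairs (site sequence, trajectory) for `t` steps of
the Glauber dynamics started at `x0`. -/
noncomputable def glauberProb {V S : Type*} [Fintype V] [Fintype S] [DecidableEq V]
    [DecidableEq S] (π : (V → S) → ℝ) (x0 : V → S) (t : ℕ)
    (E : Set ((Fin t → V) × (Fin (t + 1) → V → S))) : ℝ :=
  ∑ u : Fin t → V, ∑ X : Fin (t + 1) → V → S,
    Set.indicator E
      (fun p => (if p.2 0 = x0 then (1 : ℝ) else 0) * trajWeight π p.1 p.2) (u, X)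

/-- A monotone system: whenever `σ ≤ τ` coordinatewise, the spin-update distribution at
any site `u` from `τ` stochastically dominates the one from `σ`. -/
def IsMonotoneSystem {V S : Type*} [Fintype S] [LinearOrder S] [DecidableEq V]
    (π : (V → S) → ℝ) : Prop :=
  ∀ σ τ : V → S, σ ≤ τ → ∀ u : V, ∀ s : S,
    (∑ s' ∈ Finset.univ.filter (fun s' => s ≤ s'), π (Function.update σ u s'))
        / (∑ s' : S, π (Function.update σ u s'))
      ≤ (∑ s' ∈ Finset.univ.filter (fun s' => s ≤ s'), π (Function.update τ u s'))
        / (∑ s' : S, π (Function.update τ u s'))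

/-- The top configuration: every site carries the maximum spin. -/
noncomputable def topConfig (V : Type*) {S : Type*} [Fintype S] [LinearOrder S]
    [Nonempty S] : V → S :=
  fun _ => Finset.univ.max' Finset.univ_nonempty

/-- The bottom configuration: every site carries the minimum spin. -/
noncomputable def botConfig (V : Type*) {S : Type*} [Fintype S] [LinearOrder S]
    [Nonempty S] : V → S :=
  fun _ => Finset.univ.min' Finset.univ_nonempty


section helpers

set_option linter.unusedSectionVars false

theorem abel_aux {S : Type*} [LinearOrder S] (d g : S → ℝ) (hg : Antitone g) (A : Finset S) :
    (∀ s ∈ A, 0 ≤ ∑ s' ∈ A.filter (fun s' => s ≤ s'), d s') →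
    ∀ c : ℝ, (∀ s ∈ A, g s ≤ c) → ∑ s ∈ A, d s * g s ≤ c * ∑ s ∈ A, d s := by
  induction A using Finset.induction_on_min with
  | empty => intro _ c _; simp
  | insert a A ha ih =>
    intro ht c hc
    have hna : a ∉ A := fun h => lt_irrefl _ (ha a h)
    have h1 := ih (by
      intro s hs
      have := ht s (Finset.mem_insert_of_mem hs)
      rwa [Finset.filter_insert, if_neg (not_le.mpr (ha s hs))] at this)
      (g a) (fun s hs => hg (ha s hs).le)
    have h2 := ht a (Finset.mem_insert_self _ _)
    rw [Finset.filter_true_of_mem (by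
      intro s hs
      rcases Finset.mem_insert.1 hs with rfl | hs
      · exact le_rfl
      · exact (ha s hs).le)] at h2
    have h3 := mul_le_mul_of_nonneg_right (hc a (Finset.mem_insert_self _ _)) h2
    rw [Finset.sum_insert hna] at h2 h3 ⊢
    rw [Finset.sum_insert hna]
    nlinarith

theorem dom_aux {S : Type*} [Fintype S] [LinearOrder S] (p q g : S → ℝ) (hg : Antitone g)
    (hp : ∑ s, p s = 1) (hq : ∑ s, q s = 1)
    (h : ∀ s, ∑ s' ∈ Finset.univ.filter (fun s' => s ≤ s'), q s' ≤
      ∑ s' ∈ Finset.univ.filter (fun s' => s ≤ s'), p s') :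
    ∑ s, p s * g s ≤ ∑ s, q s * g s := by
  have := abel_aux (fun s => p s - q s) g hg Finset.univ (by
    intro s _
    rw [Finset.sum_sub_distrib]
    linarith [h s]) (∑ s, |g s|) (by
    intro s _
    exact (le_abs_self _).trans
      (Finset.single_le_sum (f := fun s => |g s|) (fun i _ => abs_nonneg _) (Finset.mem_univ s)))
  simp only [Finset.sum_sub_distrib, sub_mul, hp, hq] at this
  linarith

variable {V S : Type*} [Fintype V] [DecidableEq V] [Fintype S]

noncomputable def siteKer [DecidableEq S] (π : (V → S) → ℝ) (v : V) (x y : V → S) : ℝ :=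
  if y = Function.update x v (y v) then updProb π x v (y v) else 0

theorem sum_siteKer [DecidableEq S] (π : (V → S) → ℝ) (v : V) (x : V → S) (h : (V → S) → ℝ) :
    ∑ y, siteKer π v x y * h y = ∑ s, updProb π x v s * h (Function.update x v s) := by
  unfold siteKer
  simp only [ite_mul, zero_mul]
  rw [← Finset.sum_filter]
  refine Finset.sum_nbij' (fun y => y v) (fun s => Function.update x v s) ?_ ?_ ?_ ?_ ?_
  · simp
  · intro s _; simp
  · intro y hy
    exact (Finset.mem_filter.1 hy).2.symm
  · intro s _; simp
  · intro y hy
    have := (Finset.mem_filter.1 hy).2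
    rw [← this]

theorem sum_updProb [Nonempty S] (π : (V → S) → ℝ) (hπpos : ∀ σ, 0 < π σ) (x : V → S) (v : V) :
    ∑ s, updProb π x v s = 1 := by
  unfold updProb
  rw [← Finset.sum_div]
  exact div_self (Finset.sum_pos (fun s _ => hπpos _) Finset.univ_nonempty).ne'

theorem siteKer_one [DecidableEq S] [Nonempty S] (π : (V → S) → ℝ) (hπpos : ∀ σ, 0 < π σ)
    (x : V → S) (v : V) : ∑ y, siteKer π v x y = 1 := by
  have := sum_siteKer π v x (fun _ => 1)
  simp only [mul_one] at this
  rw [this, sum_updProb π hπpos]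

theorem siteKer_balance_aux [DecidableEq S] (π : (V → S) → ℝ) (v : V) (x y : V → S)
    (h : y = Function.update x v (y v)) :
    π x * siteKer π v x y = π y * siteKer π v y x := by
  have h' : x = Function.update y v (x v) := by
    rw [h]; simp
  have hu : ∀ s, Function.update y v s = Function.update x v s := by
    intro s; rw [h]; simp
  unfold siteKer updProb
  rw [if_pos h, if_pos h', ← h, ← h']
  simp only [hu]
  ring

theorem siteKer_balance [DecidableEq S] (π : (V → S) → ℝ) (v : V) (x y : V → S) :
    π x * siteKer π v x y = π y * siteKer π v y x := by
  by_cases h : y = Function.update x v (y v)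
  · exact siteKer_balance_aux π v x y h
  · by_cases h' : x = Function.update y v (x v)
    · exact (siteKer_balance_aux π v y x h').symm
    · unfold siteKer
      rw [if_neg h, if_neg h']; simp

theorem siteKer_stat [DecidableEq S] [Nonempty S] (π : (V → S) → ℝ) (hπpos : ∀ σ, 0 < π σ)
    (v : V) (f : (V → S) → ℝ) :
    ∑ x, π x * ∑ y, siteKer π v x y * f y = ∑ y, π y * f y := by
  simp only [Finset.mul_sum, ← mul_assoc]
  rw [Finset.sum_comm]
  refine Finset.sum_congr rfl fun y _ => ?_
  rw [← Finset.sum_mul, Finset.sum_congr rfl (fun x _ => siteKer_balance π v x y),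
    ← Finset.mul_sum, siteKer_one π hπpos, mul_one]

theorem siteKer_anti [LinearOrder S] [Nonempty S] (π : (V → S) → ℝ) (hπpos : ∀ σ, 0 < π σ)
    (hmono : IsMonotoneSystem π) (v : V) (f : (V → S) → ℝ) (hf : Antitone f) :
    Antitone (fun x => ∑ y, siteKer π v x y * f y) := by
  intro x y hxy
  simp only [sum_siteKer]
  have h1 : ∑ s, updProb π y v s * f (Function.update y v s) ≤
      ∑ s, updProb π y v s * f (Function.update x v s) := by
    refine Finset.sum_le_sum fun s _ => mul_le_mul_of_nonneg_left (hf ?_) ?_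
    · exact update_le_update_iff.2 ⟨le_rfl, fun i _ => hxy i⟩
    · exact div_nonneg (hπpos _).le (Finset.sum_nonneg fun s _ => (hπpos _).le)
  refine h1.trans (dom_aux _ _ (fun s => f (Function.update x v s)) ?_
    (sum_updProb π hπpos y v) (sum_updProb π hπpos x v) ?_)
  · intro a b hab
    exact hf (update_le_update_iff.2 ⟨hab, fun i _ => le_rfl⟩)
  · intro s
    unfold updProb
    rw [← Finset.sum_div, ← Finset.sum_div]
    exact hmono x y hxy v s

noncomputable def pathSum [DecidableEq S] (π : (V → S) → ℝ) (f : (V → S) → ℝ) (t : ℕ)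
    (u : Fin t → V) (x : V → S) : ℝ :=
  ∑ X : Fin (t + 1) → V → S, (if X 0 = x then (1 : ℝ) else 0) *
    ((∏ k : Fin t, siteKer π (u k) (X k.castSucc) (X k.succ)) * f (X (Fin.last t)))

theorem pathSum_zero [DecidableEq S] (π : (V → S) → ℝ) (f : (V → S) → ℝ)
    (u : Fin 0 → V) (x : V → S) : pathSum π f 0 u x = f x := by
  unfold pathSum
  rw [← (Equiv.funUnique (Fin 1) (V → S)).symm.sum_comp]
  simp

theorem pathSum_succ [DecidableEq S] (π : (V → S) → ℝ) (f : (V → S) → ℝ) (t : ℕ)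
    (u : Fin (t + 1) → V) (x : V → S) :
    pathSum π f (t + 1) u x =
      ∑ y, siteKer π (u 0) x y * pathSum π f t (fun k => u k.succ) y := by
  unfold pathSum
  rw [← (Fin.consEquiv (fun _ : Fin (t + 2) => V → S)).sum_comp, Fintype.sum_prod_type]
  simp only [Fin.consEquiv_apply, Fin.cons_zero, ite_mul, one_mul, zero_mul]
  rw [Finset.sum_eq_single x (by intro b _ hb; simp [hb]) (by simp)]
  simp only [if_true, Finset.mul_sum]
  rw [Finset.sum_comm]
  refine Finset.sum_congr rfl fun X _ => ?_
  simp only [mul_ite, mul_zero]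
  rw [Finset.sum_ite_eq]
  simp only [Finset.mem_univ, if_true]
  rw [Fin.prod_univ_succ, ← Fin.succ_last]
  simp only [Fin.castSucc_zero, Fin.cons_zero, Fin.cons_succ, ← Fin.succ_castSucc]
  ring

theorem pathSum_one [DecidableEq S] [Nonempty S] (π : (V → S) → ℝ) (hπpos : ∀ σ, 0 < π σ)
    (t : ℕ) : ∀ (u : Fin t → V) (x : V → S), pathSum π (fun _ => 1) t u x = 1 := by
  induction t with
  | zero => intro u x; rw [pathSum_zero]
  | succ t ih => intro u x; simp only [pathSum_succ, ih, mul_one, siteKer_one π hπpos]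

theorem pathSum_stat [DecidableEq S] [Nonempty S] (π : (V → S) → ℝ) (hπpos : ∀ σ, 0 < π σ)
    (f : (V → S) → ℝ) (t : ℕ) :
    ∀ (u : Fin t → V), ∑ x, π x * pathSum π f t u x = ∑ x, π x * f x := by
  induction t with
  | zero => intro u; simp only [pathSum_zero]
  | succ t ih => intro u; simp only [pathSum_succ, siteKer_stat π hπpos, ih]

theorem pathSum_anti [LinearOrder S] [Nonempty S] (π : (V → S) → ℝ) (hπpos : ∀ σ, 0 < π σ)
    (hmono : IsMonotoneSystem π) (f : (V → S) → ℝ) (hf : Antitone f) (t : ℕ) :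
    ∀ (u : Fin t → V), Antitone (pathSum π f t u) := by
  induction t with
  | zero => intro u x y h; simp only [pathSum_zero]; exact hf h
  | succ t ih =>
    intro u
    have := siteKer_anti π hπpos hmono (u 0) _ (ih (fun k => u k.succ))
    intro x y h
    simp only [pathSum_succ]
    exact this h

theorem glauberProb_eq [DecidableEq S] (π : (V → S) → ℝ) (x0 : V → S) (t : ℕ)
    (B : Set (V → S)) (C : Set (Fin t → V)) :
    glauberProb π x0 t ({p | p.2 (Fin.last t) ∈ B} ∩ {p | p.1 ∈ C}) =
      ∑ u : Fin t → V, C.indicator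
        (fun u => (1 / (Fintype.card V : ℝ)) ^ t * pathSum π (B.indicator 1) t u x0) u := by
  classical
  unfold glauberProb
  refine Finset.sum_congr rfl fun u _ => ?_
  by_cases hu : u ∈ C
  · rw [Set.indicator_of_mem hu]
    unfold pathSum
    rw [Finset.mul_sum]
    refine Finset.sum_congr rfl fun X _ => ?_
    by_cases hX : X (Fin.last t) ∈ B
    · simp only [trajWeight, Finset.prod_mul_distrib]
      simp [Set.indicator, hu, hX, siteKer]
    · simp [Set.indicator, hX]
  · simp [Set.indicator, hu]

end helpers

/-- For the Glauber dynamics of a monotone system started at the top configuration `⊤`,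
conditioned on `T ≤ t` (every site selected by time `t`), the probability of being at
the bottom configuration `⊥` at time `t` is at most `π ⊥`. -/
theorem glauber_monotone_bottom_bound {V S : Type*} [Fintype V] [DecidableEq V]
    [Fintype S] [LinearOrder S] [Nonempty S]
    (π : (V → S) → ℝ) (hπpos : ∀ σ, 0 < π σ) (hπ1 : ∑ σ : V → S, π σ = 1)
    (hmono : IsMonotoneSystem π) (t : ℕ)
    (hpos : 0 < glauberProb π (topConfig V) t {p | ∀ v : V, ∃ k, p.1 k = v}) :
    glauberProb π (topConfig V) t
        ({p | p.2 (Fin.last t) = botConfig V} ∩ {p | ∀ v : V, ∃ k, p.1 k = v})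
      / glauberProb π (topConfig V) t {p | ∀ v : V, ∃ k, p.1 k = v}
    ≤ π (botConfig V) := by
  have hnum := glauberProb_eq π (topConfig V) t {botConfig V} {u | ∀ v : V, ∃ k, u k = v}
  have hden := glauberProb_eq π (topConfig V) t Set.univ {u | ∀ v : V, ∃ k, u k = v}
  simp only [Set.mem_singleton_iff, Set.mem_univ, Set.ofPred_true, Set.univ_inter,
    Set.mem_ofPred_eq] at hnum hden
  rw [div_le_iff₀ hpos, hnum, hden, Finset.mul_sum]
  refine Finset.sum_le_sum fun u _ => ?_
  have hone : pathSum π (Set.univ.indicator 1) t u (topConfig V) = 1 := by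
    rw [Set.indicator_univ]
    exact pathSum_one π hπpos t u _
  have hbot : ∀ x : V → S, botConfig V ≤ x := fun x v => Finset.min'_le _ _ (Finset.mem_univ _)
  have htop : ∀ x : V → S, x ≤ topConfig V := fun x v => Finset.le_max' _ _ (Finset.mem_univ _)
  have hf : Antitone (Set.indicator {botConfig V} (1 : (V → S) → ℝ)) := by
    intro x y hxy
    by_cases hy : y = botConfig V
    · have hx : x = botConfig V := le_antisymm (hy ▸ hxy) (hbot x)
      rw [hx, hy]
    · rw [Set.indicator_of_notMem (by simpa using hy)]
      exact Set.indicator_nonneg (fun _ _ => zero_le_one) _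
  have hle : pathSum π (Set.indicator {botConfig V} 1) t u (topConfig V) ≤ π (botConfig V) := by
    have hs := pathSum_stat π hπpos (Set.indicator {botConfig V} 1) t u
    have hr : ∑ x, π x * Set.indicator {botConfig V} (1 : (V → S) → ℝ) x = π (botConfig V) := by
      simp [Set.indicator]
    rw [← hr, ← hs]
    calc _ = ∑ x, π x * pathSum π (Set.indicator {botConfig V} 1) t u (topConfig V) := by
          rw [← Finset.sum_mul, hπ1, one_mul]
      _ ≤ _ := Finset.sum_le_sum fun x _ => mul_le_mul_of_nonneg_left
          (pathSum_anti π hπpos hmono _ hf t u (htop x)) (hπpos x).le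
  by_cases hu : u ∈ {u : Fin t → V | ∀ v : V, ∃ k, u k = v}
  · rw [Set.indicator_of_mem hu, Set.indicator_of_mem hu, hone, mul_one, mul_comm (π _)]
    exact mul_le_mul_of_nonneg_left hle (by positivity)
  · rw [Set.indicator_of_notMem hu, Set.indicator_of_notMem hu, mul_zero]
end
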